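/- arXiv:2005.12107 — 3 statements merged into one kernel-verified Lean document; each statement's English description precedes it below -/
import Mathlib

section
/- Let θ ∈ ℝ, let G be a finite simple graph, let a be a θ-special vertex of G, and let u ≠ a be a θ-neutral vertex of G. Then u is θ-neutral in G−a: mult(θ, (G−a)−u) = mult(θ, G−a). -/
open Polynomial

/-- The matching polynomial of a finite simple graph `G`:
`μ(G,z) = ∑_k (-1)^k p(k,G) z^(n-2k)`, written as a sum over all matchings
(finsets of pairwise disjoint edges). -/
noncomputable def matchingPolynomial {V : Type*} [Finite V] (G : SimpleGraph V) :
    Polynomial ℝ := by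
  classical
  have : Fintype V := Fintype.ofFinite V
  exact ∑ M ∈ Finset.univ.filter
      (fun M : Finset (Sym2 V) =>
        (∀ e ∈ M, e ∈ G.edgeSet) ∧ ∀ e ∈ M, ∀ f ∈ M, e ≠ f → ∀ v, v ∈ e → v ∉ f),
    (-1 : Polynomial ℝ) ^ M.card * X ^ (Nat.card V - 2 * M.card)

/-- `matchMult θ G` is the multiplicity of `θ` as a root of the matching polynomial
of `G` (equal to `0` if `θ` is not a root). -/
noncomputable def matchMult {V : Type*} [Finite V] (θ : ℝ) (G : SimpleGraph V) : ℕ :=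
  Polynomial.rootMultiplicity θ (matchingPolynomial G)

/-- A vertex `u` is `θ`-essential if `mult(θ, G-u) = mult(θ, G) - 1`. -/
def IsEssential {V : Type*} [Finite V] (θ : ℝ) (G : SimpleGraph V) (u : V) : Prop :=
  matchMult θ (G.induce {v | v ≠ u}) + 1 = matchMult θ G

/-- A vertex `u` is `θ`-positive if `mult(θ, G-u) = mult(θ, G) + 1`. -/
def IsPositive {V : Type*} [Finite V] (θ : ℝ) (G : SimpleGraph V) (u : V) : Prop :=
  matchMult θ (G.induce {v | v ≠ u}) = matchMult θ G + 1

/-- A vertex `u` is `θ`-neutral if `mult(θ, G-u) = mult(θ, G)`. -/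
def IsNeutral {V : Type*} [Finite V] (θ : ℝ) (G : SimpleGraph V) (u : V) : Prop :=
  matchMult θ (G.induce {v | v ≠ u}) = matchMult θ G

/-- A vertex is `θ`-special if it is not `θ`-essential but has a `θ`-essential neighbor. -/
def IsSpecial {V : Type*} [Finite V] (θ : ℝ) (G : SimpleGraph V) (u : V) : Prop :=
  ¬ IsEssential θ G u ∧ ∃ w, G.Adj u w ∧ IsEssential θ G w

/-- The outer vertex boundary `∂S`: vertices not in `S` with a neighbor in `S`. -/
def vertexBoundary {V : Type*} (G : SimpleGraph V) (S : Set V) : Set V :=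
  {v | v ∉ S ∧ ∃ w ∈ S, G.Adj v w}

namespace NeutralStable

/-- sums of squares of real polynomials -/
def SOS (f : ℝ[X]) : Prop := ∃ L : List ℝ[X], f = (L.map (fun g => g ^ 2)).sum

lemma SOS.zero : SOS 0 := ⟨[], by simp⟩

lemma SOS.sq (g : ℝ[X]) : SOS (g ^ 2) := ⟨[g], by simp⟩

lemma SOS.add {f g : ℝ[X]} (hf : SOS f) (hg : SOS g) : SOS (f + g) := by
  obtain ⟨L, rfl⟩ := hf
  obtain ⟨K, rfl⟩ := hg
  exact ⟨L ++ K, by simp⟩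

lemma SOS.sum {ι : Type*} (s : Finset ι) (f : ι → ℝ[X]) (h : ∀ i ∈ s, SOS (f i)) :
    SOS (∑ i ∈ s, f i) := by
  classical
  induction s using Finset.induction_on with
  | empty => simpa using SOS.zero
  | insert a s ha ih =>
    rw [Finset.sum_insert ha]
    exact (h a (by simp)).add (ih (fun i hi => h i (by simp [hi])))

lemma list_eval (θ : ℝ) (L : List ℝ[X]) :
    0 ≤ (L.map (fun g => g ^ 2)).sum.eval θ ∧
      ((L.map (fun g => g ^ 2)).sum.eval θ = 0 → ∀ g ∈ L, g.eval θ = 0) := by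
  induction L with
  | nil => simp
  | cons a L ih =>
    obtain ⟨h1, h2⟩ := ih
    simp only [List.map_cons, List.sum_cons, eval_add, eval_pow]
    refine ⟨by positivity, fun h => ?_⟩
    have ha := sq_nonneg (a.eval θ)
    have h3 : (a.eval θ) ^ 2 = 0 := by linarith
    have h4 := h2 (by linarith)
    intro g hg
    rcases List.mem_cons.1 hg with rfl | hg
    · exact pow_eq_zero_iff (two_ne_zero) |>.1 h3
    · exact h4 g hg

lemma list_factor (θ : ℝ) (L : List ℝ[X]) (h : ∀ g ∈ L, g.eval θ = 0) :
    ∃ K : List ℝ[X], L = K.map (fun g => (X - C θ) * g) := by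
  induction L with
  | nil => exact ⟨[], rfl⟩
  | cons a L ih =>
    obtain ⟨K, hK⟩ := ih (fun g hg => h g (by simp [hg]))
    obtain ⟨b, hb⟩ := dvd_iff_isRoot.2 (h a (by simp))
    exact ⟨b :: K, by simp [← hK, ← hb]⟩

lemma list_sum_factor (p : ℝ[X]) (K : List ℝ[X]) :
    ((K.map (fun g => p * g)).map (fun g => g ^ 2)).sum
      = p ^ 2 * (K.map (fun g => g ^ 2)).sum := by
  induction K with
  | nil => simp
  | cons a K ih =>
    simp only [List.map_cons, List.sum_cons, ih]
    ring

lemma list_dvd (θ : ℝ) (j : ℕ) : ∀ (L : List ℝ[X]),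
    (X - C θ) ^ (2 * j + 1) ∣ (L.map (fun g => g ^ 2)).sum →
      ∀ g ∈ L, (X - C θ) ^ (j + 1) ∣ g := by
  induction j with
  | zero =>
    intro L h g hg
    simp only [mul_zero, zero_add, pow_one] at h ⊢
    exact dvd_iff_isRoot.2 ((list_eval θ L).2 (dvd_iff_isRoot.1 h) g hg)
  | succ j ih =>
    intro L h
    have h1 : (X - C θ) ∣ (L.map (fun g => g ^ 2)).sum :=
      (dvd_pow_self _ (by omega)).trans h
    obtain ⟨K, rfl⟩ := list_factor θ L ((list_eval θ L).2 (dvd_iff_isRoot.1 h1))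
    rw [list_sum_factor, show 2 * (j + 1) + 1 = 2 + (2 * j + 1) by ring, pow_add] at h
    have h2 := (mul_dvd_mul_iff_left (pow_ne_zero 2 (X_sub_C_ne_zero θ))).1 h
    intro g hg
    obtain ⟨b, hb, rfl⟩ := List.mem_map.1 hg
    rw [pow_succ' _ (j + 1)]
    exact mul_dvd_mul_left _ (ih K h2 b hb)

lemma SOS.dvd_left {θ : ℝ} {j : ℕ} {g h : ℝ[X]} (hh : SOS h)
    (hd : (X - C θ) ^ (2 * j + 1) ∣ g ^ 2 + h) : (X - C θ) ^ (j + 1) ∣ g := by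
  obtain ⟨L, rfl⟩ := hh
  exact list_dvd θ j (g :: L) (by simpa using hd) g (by simp)

lemma SOS.dvd_succ {θ : ℝ} {j : ℕ} {f : ℝ[X]} (hf : SOS f)
    (hd : (X - C θ) ^ (2 * j + 1) ∣ f) : (X - C θ) ^ (2 * j + 2) ∣ f := by
  obtain ⟨L, rfl⟩ := hf
  have := list_dvd θ j L hd
  apply List.dvd_sum
  intro x hx
  obtain ⟨g, hg, rfl⟩ := List.mem_map.1 hx
  rw [show 2 * j + 2 = (j + 1) * 2 by ring, pow_mul]
  exact pow_dvd_pow_of_dvd (this g hg) 2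

section abstract_rec

open Classical in
/-- the matching polynomial recurrence -/
def MRec {V : Type*} (G : SimpleGraph V) (m : Finset V → ℝ[X]) : Prop :=
  m ∅ = 1 ∧ ∀ S : Finset V, ∀ u ∈ S, m S = X * m (S.erase u) -
    ∑ v ∈ (S.erase u).filter (fun v => G.Adj u v), m ((S.erase u).erase v)

variable {V : Type*} [DecidableEq V] {G : SimpleGraph V} {m : Finset V → ℝ[X]}

open Classical in
lemma MRec.step (h : MRec G m) {S : Finset V} {u : V} (hu : u ∈ S) :
    m S = X * m (S.erase u) -
      ∑ v ∈ S.erase u, if G.Adj u v then m ((S.erase u).erase v) else 0 := by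
  rw [← Finset.sum_filter]
  convert h.2 S u hu

lemma MRec.coeffs (h : MRec G m) : ∀ (k : ℕ) (S : Finset V), S.card = k →
    (∀ n, k < n → (m S).coeff n = 0) ∧ (m S).coeff k = 1 := by
  classical
  intro k
  induction k using Nat.strong_induction_on with
  | _ k ih =>
    intro S hS
    rcases S.eq_empty_or_nonempty with rfl | ⟨u, hu⟩
    · simp only [Finset.card_empty] at hS
      subst hS
      rw [h.1]
      refine ⟨fun n hn => ?_, by simp⟩
      rw [coeff_one, if_neg (by omega)]
    · have hc := Finset.card_erase_of_mem hu
      have hp : 0 < S.card := Finset.card_pos.2 ⟨u, hu⟩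
      obtain ⟨k, rfl⟩ : ∃ k', k = k' + 1 := ⟨k - 1, by omega⟩
      have h1 := ih k (by omega) (S.erase u) (by omega)
      have h2 : ∀ n, k < n →
          (∑ v ∈ S.erase u, if G.Adj u v then m ((S.erase u).erase v) else 0).coeff n = 0 := by
        intro n hn
        rw [finsetSum_coeff]
        refine Finset.sum_eq_zero fun v hv => ?_
        have hc2 := Finset.card_erase_of_mem hv
        have hp2 : 0 < (S.erase u).card := Finset.card_pos.2 ⟨v, hv⟩
        split_ifs
        · exact (ih (k - 1) (by omega) _ (by omega)).1 n (by omega)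
        · simp
      constructor
      · intro n hn
        obtain ⟨n, rfl⟩ : ∃ n', n = n' + 1 := ⟨n - 1, by omega⟩
        rw [h.step hu, coeff_sub, coeff_X_mul, h1.1 n (by omega), h2 _ (by omega), sub_zero]
      · rw [h.step hu, coeff_sub, coeff_X_mul, h1.2, h2 _ (by omega), sub_zero]

lemma MRec.ne_zero (h : MRec G m) (S : Finset V) : m S ≠ 0 := by
  intro h0
  have := (h.coeffs _ S rfl).2
  rw [h0] at this
  simp at this

lemma MRec.deriv (h : MRec G m) : ∀ (k : ℕ) (S : Finset V), S.card = k →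
    derivative (m S) = ∑ u ∈ S, m (S.erase u) := by
  classical
  intro k
  induction k using Nat.strong_induction_on with
  | _ k ih =>
    intro S hS
    rcases S.eq_empty_or_nonempty with rfl | ⟨u, hu⟩
    · rw [h.1]; simp
    · have hc := Finset.card_erase_of_mem hu
      have hp : 0 < S.card := Finset.card_pos.2 ⟨u, hu⟩
      rw [h.step hu, derivative_sub, derivative_mul, derivative_X, one_mul,
        ih (k - 1) (by omega) _ (by omega), derivative_sum, ← Finset.add_sum_erase S _ hu,
        add_sub_assoc]
      congr 1
      have e1 : ∀ v ∈ S.erase u,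
          derivative (if G.Adj u v then m ((S.erase u).erase v) else 0) =
          ∑ w ∈ S.erase u, if w ≠ v ∧ G.Adj u v then m (((S.erase u).erase v).erase w) else 0 := by
        intro v hv
        have hc2 := Finset.card_erase_of_mem hv
        split_ifs with ha
        · rw [ih (k - 2) (by omega) _ (by omega)]
          simp only [ha, and_true]
          rw [← Finset.sum_filter]
          congr 1
          ext w; simp; tauto
        · simp [ha]
      rw [Finset.sum_congr rfl e1, Finset.sum_comm, Finset.mul_sum, ← Finset.sum_sub_distrib]
      refine Finset.sum_congr rfl fun w hw => ?_
      have hw' : u ∈ S.erase w := by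
        simp only [Finset.mem_erase] at hw ⊢
        exact ⟨hw.1.symm, hu⟩
      rw [h.step hw', Finset.erase_right_comm (a := w)]
      congr 1
      rw [← Finset.sum_erase (s := S.erase u) (a := w) (by simp)]
      refine Finset.sum_congr rfl fun v hv => ?_
      have hvw : w ≠ v := (Finset.ne_of_mem_erase hv).symm
      simp only [hvw, ne_eq, not_false_eq_true, true_and]
      rw [Finset.erase_right_comm (a := v)]

open Classical in
lemma MRec.HL (h : MRec G m) : ∀ (k : ℕ) (S : Finset V), S.card = k →
    ∀ u ∈ S, ∀ v ∈ S, u ≠ v → ∃ f, SOS f ∧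
      m (S.erase u) * m (S.erase v) - m S * m ((S.erase u).erase v) =
        (if G.Adj u v then m ((S.erase u).erase v) ^ 2 else 0) + f := by
  intro k
  induction k with
  | zero =>
    intro S hS u hu
    simp [Finset.card_eq_zero.1 hS] at hu
  | succ k ih =>
    intro S hS u hu v hv huv
    have hc := Finset.card_erase_of_mem hu
    have hv' : v ∈ S.erase u := Finset.mem_erase.2 ⟨huv.symm, hv⟩
    have hu' : u ∈ S.erase v := Finset.mem_erase.2 ⟨huv, hu⟩
    refine ⟨∑ w ∈ (S.erase u).erase v, if G.Adj u w then
      (m ((S.erase u).erase w) * m ((S.erase u).erase v)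
        - m (S.erase u) * m (((S.erase u).erase w).erase v)) else 0, ?_, ?_⟩
    · refine SOS.sum _ _ fun w hw => ?_
      split_ifs
      · obtain ⟨f, hf, e⟩ := ih (S.erase u) (by omega) w (Finset.mem_of_mem_erase hw) v hv'
          (Finset.ne_of_mem_erase hw)
        rw [e]
        refine SOS.add ?_ hf
        split_ifs
        · exact SOS.sq _
        · exact SOS.zero
      · exact SOS.zero
    · have e1 := h.step hu
      have e2 := h.step hu'
      rw [Finset.erase_right_comm (a := v)] at e2
      rw [← Finset.add_sum_erase _ _ hv'] at e1
      have e3 : (∑ w ∈ (S.erase u).erase v, if G.Adj u w then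
          (m ((S.erase u).erase w) * m ((S.erase u).erase v)
          - m (S.erase u) * m (((S.erase u).erase w).erase v)) else 0) =
          (∑ w ∈ (S.erase u).erase v, if G.Adj u w then m ((S.erase u).erase w) else 0)
            * m ((S.erase u).erase v) -
          m (S.erase u) * ∑ w ∈ (S.erase u).erase v,
            if G.Adj u w then m (((S.erase u).erase v).erase w) else 0 := by
        rw [Finset.sum_mul, Finset.mul_sum, ← Finset.sum_sub_distrib]
        refine Finset.sum_congr rfl fun w hw => ?_
        split_ifs
        · rw [Finset.erase_right_comm (a := w)]
        · simp
      rw [e3, e1, e2]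
      split_ifs <;> ring

lemma MRec.HL' (h : MRec G m) {S : Finset V} {u v : V} (hu : u ∈ S) (hv : v ∈ S) (huv : u ≠ v) :
    SOS (m (S.erase u) * m (S.erase v) - m S * m ((S.erase u).erase v)) := by
  classical
  obtain ⟨f, hf, e⟩ := h.HL _ S rfl u hu v hv huv
  rw [e]
  refine SOS.add ?_ hf
  split_ifs
  · exact SOS.sq _
  · exact SOS.zero

lemma MRec.lower (h : MRec G m) (θ : ℝ) {S : Finset V} {u : V} (hu : u ∈ S) :
    rootMultiplicity θ (m S) ≤ rootMultiplicity θ (m (S.erase u)) + 1 := by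
  by_contra! hlt
  set l := rootMultiplicity θ (m (S.erase u)) with hl
  have hS : (X - C θ) ^ (l + 2) ∣ m S := (le_rootMultiplicity_iff (h.ne_zero S)).1 (by omega)
  have hE : (X - C θ) ^ l ∣ m (S.erase u) := (le_rootMultiplicity_iff (h.ne_zero _)).1 le_rfl
  have hS' : (X - C θ) ^ (l + 1) ∣ derivative (m S) := by
    obtain ⟨q, hq⟩ := hS
    rw [hq, derivative_mul]
    refine dvd_add (Dvd.dvd.mul_right ?_ _) (Dvd.dvd.mul_right (pow_dvd_pow _ (by omega)) _)
    rw [derivative_X_sub_C_pow]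
    exact Dvd.dvd.mul_left (by simp) _
  have key : m (S.erase u) * derivative (m S) - m S * derivative (m (S.erase u)) =
      m (S.erase u) ^ 2 + ∑ v ∈ S.erase u,
        (m (S.erase u) * m (S.erase v) - m S * m ((S.erase u).erase v)) := by
    rw [h.deriv _ S rfl, h.deriv _ (S.erase u) rfl, ← Finset.add_sum_erase S _ hu,
      Finset.sum_sub_distrib, ← Finset.mul_sum, ← Finset.mul_sum]
    ring
  have hd : (X - C θ) ^ (2 * l + 1) ∣
      m (S.erase u) * derivative (m S) - m S * derivative (m (S.erase u)) := by
    apply dvd_sub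
    · rw [show 2 * l + 1 = l + (l + 1) by ring, pow_add]
      exact mul_dvd_mul hE hS'
    · rcases Nat.eq_zero_or_pos l with h0 | h0
      · exact Dvd.dvd.mul_right ((pow_dvd_pow _ (by omega)).trans hS) _
      · have : (X - C θ) ^ (l - 1) ∣ derivative (m (S.erase u)) := by
          obtain ⟨q, hq⟩ := hE
          rw [hq, derivative_mul]
          refine dvd_add (Dvd.dvd.mul_right ?_ _) (Dvd.dvd.mul_right (pow_dvd_pow _ (by omega)) _)
          rw [derivative_X_sub_C_pow]
          exact Dvd.dvd.mul_left (by simp) _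
        rw [show 2 * l + 1 = (l + 2) + (l - 1) by omega, pow_add]
        exact mul_dvd_mul hS this
  rw [key] at hd
  have hs : SOS (∑ v ∈ S.erase u,
        (m (S.erase u) * m (S.erase v) - m S * m ((S.erase u).erase v))) :=
    SOS.sum _ _ fun v hv => h.HL' hu (Finset.mem_of_mem_erase hv) (Finset.ne_of_mem_erase hv).symm
  have := (le_rootMultiplicity_iff (h.ne_zero _)).2 (hs.dvd_left hd)
  omega

lemma MRec.upper (h : MRec G m) (θ : ℝ) {S : Finset V} {u : V} (hu : u ∈ S) :
    rootMultiplicity θ (m (S.erase u)) ≤ rootMultiplicity θ (m S) + 1 := by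
  classical
  rcases Nat.eq_zero_or_pos (rootMultiplicity θ (m (S.erase u))) with h0 | h0
  · omega
  obtain ⟨l, hl⟩ : ∃ l, rootMultiplicity θ (m (S.erase u)) = l + 1 :=
    ⟨rootMultiplicity θ (m (S.erase u)) - 1, by omega⟩
  rw [hl, add_le_add_iff_right, le_rootMultiplicity_iff (h.ne_zero _), h.step hu]
  apply dvd_sub
  · apply Dvd.dvd.mul_left
    exact (le_rootMultiplicity_iff (h.ne_zero _)).1 (by omega)
  · apply Finset.dvd_sum
    intro v hv
    split_ifs
    · have := h.lower θ hv
      exact (le_rootMultiplicity_iff (h.ne_zero _)).1 (by omega)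
    · exact dvd_zero _

/-- If `w` is essential and `u` is neutral, then they are not adjacent and `w` is essential in
`S - u`. -/
lemma MRec.key (h : MRec G m) (θ : ℝ) {S : Finset V} {u w : V} (hu : u ∈ S) (hw : w ∈ S)
    (hess : rootMultiplicity θ (m (S.erase w)) + 1 = rootMultiplicity θ (m S))
    (hneu : rootMultiplicity θ (m (S.erase u)) = rootMultiplicity θ (m S)) :
    rootMultiplicity θ (m ((S.erase u).erase w)) + 1 = rootMultiplicity θ (m (S.erase u)) ∧
      ¬ G.Adj u w := by
  classical
  have huw : u ≠ w := by rintro rfl; omega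
  have hw' : w ∈ S.erase u := Finset.mem_erase.2 ⟨huw.symm, hw⟩
  have hlow := h.lower θ hw'
  have hsos := h.HL' hu hw huw
  set j := rootMultiplicity θ (m (S.erase w)) with hj
  have dS : (X - C θ) ^ (j + 1) ∣ m S := (le_rootMultiplicity_iff (h.ne_zero _)).1 (by omega)
  have du : (X - C θ) ^ (j + 1) ∣ m (S.erase u) :=
    (le_rootMultiplicity_iff (h.ne_zero _)).1 (by omega)
  have dw : (X - C θ) ^ j ∣ m (S.erase w) := (le_rootMultiplicity_iff (h.ne_zero _)).1 (by omega)
  have duw : (X - C θ) ^ j ∣ m ((S.erase u).erase w) :=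
    (le_rootMultiplicity_iff (h.ne_zero _)).1 (by omega)
  have hd : (X - C θ) ^ (2 * j + 1) ∣
      m (S.erase u) * m (S.erase w) - m S * m ((S.erase u).erase w) := by
    rw [show 2 * j + 1 = (j + 1) + j by ring, pow_add]
    exact dvd_sub (mul_dvd_mul du dw) (mul_dvd_mul dS duw)
  have hd2 := hsos.dvd_succ hd
  have hup : rootMultiplicity θ (m ((S.erase u).erase w)) ≤ j := by
    by_contra! hlt
    have h1 : (X - C θ) ^ (j + 1) ∣ m ((S.erase u).erase w) :=
      (le_rootMultiplicity_iff (h.ne_zero _)).1 (by omega)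
    have h2 : (X - C θ) ^ (2 * j + 2) ∣ m S * m ((S.erase u).erase w) := by
      rw [show 2 * j + 2 = (j + 1) + (j + 1) by ring, pow_add]
      exact mul_dvd_mul dS h1
    have h3 : (X - C θ) ^ (2 * j + 2) ∣ m (S.erase u) * m (S.erase w) := by
      simpa using dvd_add hd2 h2
    have h4 := (le_rootMultiplicity_iff (mul_ne_zero (h.ne_zero _) (h.ne_zero _))).2 h3
    rw [rootMultiplicity_mul (mul_ne_zero (h.ne_zero _) (h.ne_zero _))] at h4
    omega
  refine ⟨by omega, fun hadj => ?_⟩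
  obtain ⟨f, hf, e⟩ := h.HL _ S rfl u hu w hw huw
  rw [e, if_pos hadj] at hd
  have := (le_rootMultiplicity_iff (h.ne_zero _)).2 (hf.dvd_left hd)
  omega

lemma MRec.main (h : MRec G m) (θ : ℝ) {S : Finset V} {u w a : V} (hu : u ∈ S) (hw : w ∈ S)
    (ha : a ∈ S) (hua : u ≠ a) (hadj : G.Adj a w)
    (hess : rootMultiplicity θ (m (S.erase w)) + 1 = rootMultiplicity θ (m S))
    (hneu : rootMultiplicity θ (m (S.erase u)) = rootMultiplicity θ (m S))
    (hna : ¬ rootMultiplicity θ (m (S.erase a)) + 1 = rootMultiplicity θ (m S)) :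
    rootMultiplicity θ (m ((S.erase a).erase u)) = rootMultiplicity θ (m (S.erase a)) := by
  have huw : u ≠ w := by rintro rfl; omega
  have hw' : w ∈ S.erase u := Finset.mem_erase.2 ⟨huw.symm, hw⟩
  have ha' : a ∈ S.erase u := Finset.mem_erase.2 ⟨hua.symm, ha⟩
  have hu' : u ∈ S.erase a := Finset.mem_erase.2 ⟨hua, hu⟩
  have h1 := (h.key θ hu hw hess hneu).1
  have h2 : rootMultiplicity θ (m (S.erase a)) ≠ rootMultiplicity θ (m S) :=
    fun e => (h.key θ ha hw hess e).2 hadj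
  have h3 : rootMultiplicity θ (m ((S.erase u).erase a)) ≠ rootMultiplicity θ (m (S.erase u)) :=
    fun e => (h.key θ ha' hw' h1 e).2 hadj
  have l1 := h.lower θ ha
  have l2 := h.upper θ ha
  have l3 := h.lower θ ha'
  have l4 := h.upper θ ha'
  have l5 := h.lower θ hu'
  have l6 := h.upper θ hu'
  rw [Finset.erase_right_comm] at l5 l6 ⊢
  omega

end abstract_rec

section concrete

variable {V : Type*}

/-- `M` is a matching of `G` inside the vertex set `S` -/
def IsM (G : SimpleGraph V) (S : Finset V) (M : Finset (Sym2 V)) : Prop :=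
  (∀ e ∈ M, e ∈ G.edgeSet ∧ ∀ v ∈ e, v ∈ S) ∧
    ∀ e ∈ M, ∀ f ∈ M, e ≠ f → ∀ v, v ∈ e → v ∉ f

open Classical in
/-- matching polynomial of the subgraph induced on `S` -/
noncomputable def mS [Fintype V] (G : SimpleGraph V) (S : Finset V) : ℝ[X] :=
  ∑ M ∈ Finset.univ.filter (fun M : Finset (Sym2 V) => IsM G S M),
    (-1 : ℝ[X]) ^ M.card * X ^ (S.card - 2 * M.card)

lemma IsM.card_le {G : SimpleGraph V} {S : Finset V} {M : Finset (Sym2 V)} (h : IsM G S M) :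
    2 * M.card ≤ S.card := by
  classical
  have h1 : (M.biUnion (fun e => e.toFinset)).card = ∑ e ∈ M, e.toFinset.card := by
    apply Finset.card_biUnion
    intro e he f hf hef
    refine Finset.disjoint_left.2 ?_
    intro v hv hv'
    exact h.2 e he f hf hef v (Sym2.mem_toFinset.1 hv) (Sym2.mem_toFinset.1 hv')
  have h2 : ∑ e ∈ M, e.toFinset.card = ∑ e ∈ M, 2 :=
    Finset.sum_congr rfl fun e he =>
      Sym2.card_toFinset_of_not_isDiag e (G.not_isDiag_of_mem_edgeSet (h.1 e he).1)
  have h3 : M.biUnion (fun e => e.toFinset) ⊆ S := by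
    intro v hv
    obtain ⟨e, he, hv⟩ := Finset.mem_biUnion.1 hv
    exact (h.1 e he).2 v (Sym2.mem_toFinset.1 hv)
  have h4 := Finset.card_le_card h3
  rw [h1, h2] at h4
  simp at h4
  omega

lemma mS_rec [Fintype V] (G : SimpleGraph V) : MRec G (mS G) := by
  classical
  constructor
  · unfold mS
    have : Finset.univ.filter (fun M : Finset (Sym2 V) => IsM G ∅ M) = {∅} := by
      ext M
      simp only [Finset.mem_filter, Finset.mem_univ, true_and, Finset.mem_singleton]
      constructor
      · intro h
        have := h.card_le
        simpa using this
      · rintro rfl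
        exact ⟨by simp, by simp⟩
    rw [this]
    simp
  · intro S u hu
    have hc := Finset.card_erase_of_mem hu
    have hp : 0 < S.card := Finset.card_pos.2 ⟨u, hu⟩
    unfold mS
    rw [← Finset.sum_filter_add_sum_filter_not _ (fun M => ∀ e ∈ M, u ∉ e), sub_eq_add_neg]
    congr 1
    · rw [Finset.mul_sum, Finset.filter_filter]
      have : Finset.univ.filter (fun M : Finset (Sym2 V) => IsM G S M ∧ ∀ e ∈ M, u ∉ e) =
          Finset.univ.filter (fun M : Finset (Sym2 V) => IsM G (S.erase u) M) := by
        ext M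
        simp only [Finset.mem_filter, Finset.mem_univ, true_and]
        constructor
        · rintro ⟨h, hn⟩
          refine ⟨fun e he => ⟨(h.1 e he).1, fun v hv => Finset.mem_erase.2 ⟨?_, (h.1 e he).2 v hv⟩⟩,
            h.2⟩
          rintro rfl
          exact hn e he hv
        · intro h
          refine ⟨⟨fun e he => ⟨(h.1 e he).1, fun v hv =>
            Finset.mem_of_mem_erase ((h.1 e he).2 v hv)⟩, h.2⟩, fun e he hue => ?_⟩
          exact (Finset.ne_of_mem_erase ((h.1 e he).2 u hue)) rfl
      rw [this]
      refine Finset.sum_congr (by congr!) fun M hM => ?_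
      have hb := IsM.card_le (Finset.mem_filter.1 hM).2
      rw [show S.card - 2 * M.card = ((S.erase u).card - 2 * M.card) + 1 by omega, pow_succ]
      ring
    · rw [← Finset.sum_neg_distrib]
      simp_rw [← Finset.sum_neg_distrib]
      rw [Finset.sum_sigma', Finset.filter_filter]
      symm
      have memM : ∀ (v : V) (M : Finset (Sym2 V)), IsM G ((S.erase u).erase v) M →
          ∀ e ∈ M, u ∉ e ∧ v ∉ e := by
        intro v M h e he
        constructor
        · intro hh
          have := (h.1 e he).2 u hh
          simp at this
        · intro hh
          have := (h.1 e he).2 v hh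
          simp at this
      refine Finset.sum_nbij (fun p => insert s(u, p.1) p.2) ?_ ?_ ?_ ?_
      · rintro ⟨v, M⟩ hM
        simp only [Finset.mem_sigma, Finset.mem_filter, Finset.mem_univ, true_and,
          Finset.mem_erase] at hM ⊢
        obtain ⟨⟨⟨hvu, hvS⟩, hadj⟩, hM⟩ := hM
        replace hM : IsM G ((S.erase u).erase v) M := by convert hM
        have hav := memM v M hM
        refine ⟨⟨?_, ?_⟩, ?_⟩
        · intro e he
          rcases Finset.mem_insert.1 he with rfl | he
          · refine ⟨hadj, fun x hx => ?_⟩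
            rcases Sym2.mem_iff.1 hx with rfl | rfl <;> assumption
          · refine ⟨(hM.1 e he).1, fun x hx => ?_⟩
            exact Finset.mem_of_mem_erase (Finset.mem_of_mem_erase ((hM.1 e he).2 x hx))
        · intro e he f hf hef x hxe hxf
          rcases Finset.mem_insert.1 he with rfl | heM <;>
          rcases Finset.mem_insert.1 hf with rfl | hfM
          · exact hef rfl
          · rcases Sym2.mem_iff.1 hxe with rfl | rfl
            · exact (hav f hfM).1 hxf
            · exact (hav f hfM).2 hxf
          · rcases Sym2.mem_iff.1 hxf with rfl | rfl
            · exact (hav e heM).1 hxe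
            · exact (hav e heM).2 hxe
          · exact hM.2 e heM f hfM hef x hxe hxf
        · intro hh
          exact hh s(u, v) (by simp) (by simp)
      · rintro ⟨v, M⟩ hM ⟨v', M'⟩ hM' heq
        simp only [Finset.mem_coe, Finset.mem_sigma, Finset.mem_filter, Finset.mem_univ, true_and,
          Finset.mem_erase] at hM hM' heq
        have h1 := memM v M (by convert hM.2)
        have h2 := memM v' M' (by convert hM'.2)
        have hv : v = v' := by
          have : s(u, v) ∈ insert s(u, v') M' := by rw [← heq]; simp
          rcases Finset.mem_insert.1 this with e | e
          · exact Sym2.congr_right.1 e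
          · exact absurd (by simp) (h2 _ e).1
        subst hv
        have n1 : s(u, v) ∉ M := fun e => (h1 _ e).1 (by simp)
        have n2 : s(u, v) ∉ M' := fun e => (h2 _ e).1 (by simp)
        have : M = M' := by
          rw [← Finset.erase_insert n1, heq, Finset.erase_insert n2]
        subst this
        rfl
      · intro M hM
        simp only [Finset.mem_coe, Finset.mem_filter, Finset.mem_univ, true_and] at hM
        obtain ⟨hM, hcov⟩ := hM
        push Not at hcov
        obtain ⟨e, he, hue⟩ := hcov
        obtain ⟨v, rfl⟩ := Sym2.mem_iff_exists.1 hue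
        have hadj : G.Adj u v := (hM.1 _ he).1
        have hvS : v ∈ S := (hM.1 _ he).2 v (by simp)
        refine ⟨⟨v, M.erase s(u, v)⟩, ?_, by simp [Finset.insert_erase he]⟩
        simp only [Finset.mem_coe, Finset.mem_sigma, Finset.mem_filter, Finset.mem_univ, true_and]
        refine ⟨⟨Finset.mem_erase.2 ⟨hadj.ne', hvS⟩, hadj⟩, ?_⟩
        suffices IsM G ((S.erase u).erase v) (M.erase s(u, v)) by convert this
        refine ⟨fun f hf => ?_, fun f hf g hg => hM.2 f (Finset.mem_of_mem_erase hf) g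
          (Finset.mem_of_mem_erase hg)⟩
        have hfM := Finset.mem_of_mem_erase hf
        have hdis := hM.2 _ he f hfM (Finset.ne_of_mem_erase hf).symm
        refine ⟨(hM.1 f hfM).1, fun x hx => ?_⟩
        refine Finset.mem_erase.2 ⟨?_, Finset.mem_erase.2 ⟨?_, (hM.1 f hfM).2 x hx⟩⟩
        · rintro rfl
          exact hdis x (by simp) hx
        · rintro rfl
          exact hdis x (by simp) hx
      · rintro ⟨v, M⟩ hM
        simp only [Finset.mem_sigma, Finset.mem_filter, Finset.mem_univ, true_and] at hM
        have h1 := memM v M (by convert hM.2)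
        have n1 : s(u, v) ∉ M := fun e => (h1 _ e).1 (by simp)
        have hv : v ∈ S.erase u := by
          have := hM.1.1
          convert this
        have hc2 := Finset.card_erase_of_mem hv
        rw [Finset.card_insert_of_notMem n1]
        have hx : S.card - 2 * (M.card + 1) = ((S.erase u).erase v).card - 2 * M.card := by omega
        rw [hx, pow_succ]
        ring

lemma matchingPolynomial_eq [Fintype V] (G : SimpleGraph V) {W : Type*} [Finite W]
    (H : SimpleGraph W) (φ : H ↪g G) (S : Finset V) (hS : ∀ v, v ∈ S ↔ ∃ w, φ w = v) :
    matchingPolynomial H = mS G S := by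
  classical
  have hcard : Nat.card W = S.card := by
    letI := Fintype.ofFinite W
    have : S = Finset.univ.map φ.toEmbedding := by
      ext v; rw [hS]; simp
    rw [this]; simp
  unfold matchingPolynomial mS
  refine Finset.sum_nbij (fun M => M.map φ.toEmbedding.sym2Map) ?_ ?_ ?_ ?_
  · intro M hM
    simp only [Finset.mem_filter, Finset.mem_univ, true_and] at hM ⊢
    refine ⟨?_, ?_⟩
    · intro e he
      obtain ⟨f, hf, rfl⟩ := Finset.mem_map.1 he
      have := hM.1 f hf
      induction f with
      | _ x y =>
        refine ⟨by simpa using this, fun v hv => ?_⟩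
        simp at hv
        rw [hS]
        rcases hv with rfl | rfl
        · exact ⟨x, rfl⟩
        · exact ⟨y, rfl⟩
    · intro e he e' he' hne v hv hv'
      obtain ⟨f, hf, rfl⟩ := Finset.mem_map.1 he
      obtain ⟨f', hf', rfl⟩ := Finset.mem_map.1 he'
      simp only [Function.Embedding.sym2Map_apply, Sym2.mem_map] at hv hv'
      obtain ⟨x, hx, rfl⟩ := hv
      obtain ⟨x', hx', h⟩ := hv'
      obtain rfl : x' = x := φ.injective h
      exact hM.2 f hf f' hf' (fun h => hne (by rw [h])) x' hx hx'
  · intro M _ M' _ h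
    exact Finset.map_injective _ h
  · intro M hM
    simp only [Finset.mem_coe, Finset.mem_filter, Finset.mem_univ, true_and] at hM
    have hinj := φ.toEmbedding.sym2Map.injective
    refine ⟨M.preimage φ.toEmbedding.sym2Map hinj.injOn, ?_, ?_⟩
    · simp only [Finset.mem_coe, Finset.mem_filter, Finset.mem_univ, true_and, Finset.mem_preimage]
      refine ⟨?_, ?_⟩
      · intro e he
        have := (hM.1 _ he).1
        induction e with
        | _ x y => simpa using this
      · intro e he f hf hef x hx hx'
        refine hM.2 _ he _ hf (fun h => hef (hinj h)) (φ x) ?_ ?_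
        · exact Sym2.mem_map.2 ⟨x, hx, rfl⟩
        · exact Sym2.mem_map.2 ⟨x, hx', rfl⟩
    · ext e
      simp only [Finset.mem_map, Finset.mem_preimage]
      constructor
      · rintro ⟨f, hf, rfl⟩
        exact hf
      · intro he
        have := (hM.1 e he).2
        induction e with
        | _ x y =>
          obtain ⟨x', rfl⟩ := (hS x).1 (this x (by simp))
          obtain ⟨y', rfl⟩ := (hS y).1 (this y (by simp))
          exact ⟨s(x', y'), he, rfl⟩
  · intro M _
    simp [hcard]

end concrete

end NeutralStable

-- statement 10
theorem neutral_stable_under_deleting_special {V : Type*} [Finite V] (θ : ℝ)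
    (G : SimpleGraph V) (a : V) (ha : IsSpecial θ G a)
    (u : V) (hu : u ≠ a) (hneu : IsNeutral θ G u) :
    IsNeutral θ (G.induce {v | v ≠ a}) ⟨u, hu⟩ := by
  classical
  letI := Fintype.ofFinite V
  have hG : matchingPolynomial G = NeutralStable.mS G Finset.univ :=
    NeutralStable.matchingPolynomial_eq G G SimpleGraph.Embedding.refl _ (by simp)
  have h1 : ∀ x : V, matchingPolynomial (G.induce {v | v ≠ x}) =
      NeutralStable.mS G (Finset.univ.erase x) := fun x =>
    NeutralStable.matchingPolynomial_eq G _ (SimpleGraph.Embedding.induce _) _ (by simp)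
  have h2 : matchingPolynomial ((G.induce {v | v ≠ a}).induce {v | v ≠ ⟨u, hu⟩}) =
      NeutralStable.mS G ((Finset.univ.erase a).erase u) :=
    NeutralStable.matchingPolynomial_eq G _
      ((SimpleGraph.Embedding.induce _).trans (SimpleGraph.Embedding.induce _)) _ (by
        intro v
        simp only [Finset.mem_erase, Finset.mem_univ, and_true]
        constructor
        · rintro ⟨h, h'⟩
          exact ⟨⟨⟨v, h'⟩, fun e => h (congrArg Subtype.val e)⟩, rfl⟩
        · rintro ⟨⟨⟨x, hx⟩, hx'⟩, rfl⟩
          exact ⟨fun e => hx' (Subtype.ext e), hx⟩)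
  obtain ⟨hna, w, hadj, hess⟩ := ha
  unfold IsNeutral IsEssential matchMult at *
  rw [h1, hG] at hneu hna hess
  rw [h1, h2]
  exact (NeutralStable.mS_rec G).main θ (Finset.mem_univ u) (Finset.mem_univ w)
    (Finset.mem_univ a) hu hadj hess hneu hna
end

section
/- Let θ ∈ ℝ, let G be a finite simple graph, let a be a θ-special vertex of G, and let u ≠ a be a vertex that is not θ-essential in G. Then u is not θ-essential in G−a: mult(θ, (G−a)−u) ≠ mult(θ, G−a) − 1. -/
open Polynomial

namespace MatchAux

/-- `M` is a matching of `G` all of whose edges lie inside `S`. -/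
def IsMat {V : Type*} (G : SimpleGraph V) (S : Finset V) (M : Finset (Sym2 V)) : Prop :=
  (∀ e ∈ M, e ∈ G.edgeSet ∧ ∀ v ∈ e, v ∈ S) ∧ ∀ e ∈ M, ∀ f ∈ M, e ≠ f → ∀ v, v ∈ e → v ∉ f

open Classical in
/-- Multivariate matching polynomial of `G[S]`. -/
noncomputable def Q {V R : Type*} [Fintype V] [CommRing R] (G : SimpleGraph V) (S : Finset V)
    (x : V → R) : R :=
  ∑ M ∈ Finset.univ.filter (IsMat G S),
    (-1) ^ M.card * ∏ v ∈ S.filter (fun v => ∀ e ∈ M, v ∉ e), x v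

section
variable {V R : Type*} [Fintype V] [CommRing R] (G : SimpleGraph V)

theorem Q_empty (x : V → R) : Q G ∅ x = 1 := by
  classical
  unfold Q
  have : Finset.univ.filter (IsMat G (∅ : Finset V)) = {∅} := by
    ext M
    simp only [Finset.mem_filter, Finset.mem_univ, true_and, Finset.mem_singleton]
    constructor
    · rintro ⟨h, -⟩
      rw [Finset.eq_empty_iff_forall_notMem]
      intro e he
      induction e with
      | _ a b => exact absurd ((h _ he).2 a (by simp)) (by simp)
    · rintro rfl
      exact ⟨by simp, by simp⟩
  rw [this]
  simp

theorem isMat_erase_iff {V : Type*} (G : SimpleGraph V) [DecidableEq V] {S : Finset V} {v : V} {M : Finset (Sym2 V)} :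
    IsMat G (S.erase v) M ↔ IsMat G S M ∧ ∀ e ∈ M, v ∉ e := by
  unfold IsMat
  constructor
  · rintro ⟨h1, h2⟩
    refine ⟨⟨fun e he => ⟨(h1 e he).1, fun w hw => Finset.mem_of_mem_erase ((h1 e he).2 w hw)⟩, h2⟩,
      fun e he hv => ?_⟩
    exact Finset.ne_of_mem_erase ((h1 e he).2 v hv) rfl
  · rintro ⟨⟨h1, h2⟩, h3⟩
    refine ⟨fun e he => ⟨(h1 e he).1, fun w hw => Finset.mem_erase.2 ⟨?_, (h1 e he).2 w hw⟩⟩, h2⟩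
    rintro rfl
    exact h3 e he hw

open Classical in
theorem Q_rec (S : Finset V) (x : V → R) (v : V) (hv : v ∈ S) :
    Q G S x = x v * Q G (S.erase v) x
      - ∑ i ∈ (S.erase v).filter (fun i => G.Adj v i), Q G ((S.erase v).erase i) x := by
  have key1 : ∑ M ∈ (Finset.univ.filter (IsMat G S)).filter (fun M => ∀ e ∈ M, v ∉ e),
      (-1 : R) ^ M.card * ∏ v ∈ S.filter (fun v => ∀ e ∈ M, v ∉ e), x v
      = x v * Q G (S.erase v) x := by
    unfold Q
    rw [Finset.mul_sum]
    apply Finset.sum_congr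
    · ext M
      simp [isMat_erase_iff G]
    · intro M hM
      simp only [Finset.mem_filter, Finset.mem_univ, true_and, isMat_erase_iff G] at hM
      have : S.filter (fun v => ∀ e ∈ M, v ∉ e)
          = insert v ((S.erase v).filter (fun v => ∀ e ∈ M, v ∉ e)) := by
        ext w
        simp only [Finset.mem_filter, Finset.mem_insert, Finset.mem_erase]
        by_cases hw : w = v
        · subst hw; simp [hv]; exact hM.2
        · simp [hw]
      rw [this, Finset.prod_insert (by simp)]
      ring
  have key2 : ∑ M ∈ (Finset.univ.filter (IsMat G S)).filter (fun M => ¬ ∀ e ∈ M, v ∉ e),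
      (-1 : R) ^ M.card * ∏ v ∈ S.filter (fun v => ∀ e ∈ M, v ∉ e), x v
      = ∑ i ∈ (S.erase v).filter (fun i => G.Adj v i),
        ∑ M ∈ (Finset.univ.filter (IsMat G S)).filter (fun M => s(v, i) ∈ M),
        (-1 : R) ^ M.card * ∏ v ∈ S.filter (fun v => ∀ e ∈ M, v ∉ e), x v := by
    have : ∀ i, ∑ M ∈ (Finset.univ.filter (IsMat G S)).filter (fun M => s(v, i) ∈ M),
        (-1 : R) ^ M.card * ∏ v ∈ S.filter (fun v => ∀ e ∈ M, v ∉ e), x v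
        = ∑ M ∈ (Finset.univ.filter (IsMat G S)).filter (fun M => ¬ ∀ e ∈ M, v ∉ e),
          if s(v, i) ∈ M then
          (-1 : R) ^ M.card * ∏ v ∈ S.filter (fun v => ∀ e ∈ M, v ∉ e), x v else 0 := by
      intro i
      rw [← Finset.sum_filter]
      apply Finset.sum_congr _ (fun _ _ => rfl)
      ext M
      simp only [Finset.mem_filter, Finset.mem_univ, true_and]
      constructor
      · rintro ⟨h1, h2⟩
        refine ⟨⟨h1, fun h => h _ h2 (by simp)⟩, h2⟩
      · rintro ⟨⟨h1, _⟩, h2⟩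
        exact ⟨h1, h2⟩
    simp_rw [this]
    rw [Finset.sum_comm]
    apply Finset.sum_congr rfl
    intro M hM
    simp only [Finset.mem_filter, Finset.mem_univ, true_and, not_forall, not_not] at hM
    obtain ⟨⟨h1, h2⟩, e, he, hve⟩ := hM
    obtain ⟨i, rfl⟩ := Sym2.mem_iff_exists.1 hve
    have hadj : G.Adj v i := (h1 _ he).1
    rw [Finset.sum_eq_single i, if_pos he]
    · intro j _ hji
      rw [if_neg]
      intro hj
      refine h2 _ hj _ he ?_ v (by simp) (by simp)
      intro h
      exact hji (Sym2.congr_right.1 h)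
    · intro h
      exfalso
      apply h
      simp only [Finset.mem_filter, Finset.mem_erase]
      exact ⟨⟨hadj.ne', (h1 _ he).2 i (by simp)⟩, hadj⟩
  have key3 : ∀ i ∈ (S.erase v).filter (fun i => G.Adj v i),
      ∑ M ∈ (Finset.univ.filter (IsMat G S)).filter (fun M => s(v, i) ∈ M),
        (-1 : R) ^ M.card * ∏ v ∈ S.filter (fun v => ∀ e ∈ M, v ∉ e), x v
      = - Q G ((S.erase v).erase i) x := by
    intro i hi
    simp only [Finset.mem_filter, Finset.mem_erase] at hi
    obtain ⟨⟨hiv, hiS⟩, hadj⟩ := hi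
    unfold Q
    rw [← Finset.sum_neg_distrib]
    refine Finset.sum_bij' (fun M _ => M.erase s(v, i)) (fun M _ => insert s(v, i) M)
      ?_ ?_ ?_ ?_ ?_
    · intro M hM
      simp only [Finset.mem_filter, Finset.mem_univ, true_and, isMat_erase_iff G] at hM ⊢
      obtain ⟨⟨h1, h2⟩, he⟩ := hM
      refine ⟨⟨⟨fun e he' => h1 e (Finset.mem_of_mem_erase he'), fun e he' f hf' =>
        h2 e (Finset.mem_of_mem_erase he') f (Finset.mem_of_mem_erase hf')⟩, ?_⟩, ?_⟩
      · intro e he' hve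
        exact h2 e (Finset.mem_of_mem_erase he') _ he (Finset.ne_of_mem_erase he') v hve (by simp)
      · intro e he' hve
        exact h2 e (Finset.mem_of_mem_erase he') _ he (Finset.ne_of_mem_erase he') i hve (by simp)
    · intro M hM
      simp only [Finset.mem_filter, Finset.mem_univ, true_and, isMat_erase_iff G] at hM ⊢
      obtain ⟨⟨⟨h1, h2⟩, h3⟩, h4⟩ := hM
      refine ⟨⟨?_, ?_⟩, Finset.mem_insert_self _ _⟩
      · intro e he
        rcases Finset.mem_insert.1 he with rfl | he
        · refine ⟨hadj, ?_⟩
          intro w hw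
          rcases Sym2.mem_iff.1 hw with rfl | rfl <;> assumption
        · exact h1 e he
      · intro e he f hf hef w hwe hwf
        rcases Finset.mem_insert.1 he with rfl | he' <;> rcases Finset.mem_insert.1 hf with rfl | hf'
        · exact hef rfl
        · rcases Sym2.mem_iff.1 hwe with rfl | rfl
          · exact h3 f hf' hwf
          · exact h4 f hf' hwf
        · rcases Sym2.mem_iff.1 hwf with rfl | rfl
          · exact h3 e he' hwe
          · exact h4 e he' hwe
        · exact h2 e he' f hf' hef w hwe hwf
    · intro M hM
      simp only [Finset.mem_filter] at hM
      exact Finset.insert_erase hM.2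
    · intro M hM
      simp only [Finset.mem_filter, Finset.mem_univ, true_and, isMat_erase_iff G] at hM
      apply Finset.erase_insert
      intro h
      exact hM.2 _ h (by simp)
    · intro M hM
      simp only [Finset.mem_filter, Finset.mem_univ, true_and] at hM
      obtain ⟨⟨h1, h2⟩, he⟩ := hM
      have hc : M.card = (M.erase s(v, i)).card + 1 := (Finset.card_erase_add_one he).symm
      have hs : S.filter (fun v => ∀ e ∈ M, v ∉ e)
          = ((S.erase v).erase i).filter (fun w => ∀ e ∈ M.erase s(v, i), w ∉ e) := by
        ext w
        simp only [Finset.mem_filter, Finset.mem_erase]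
        constructor
        · rintro ⟨hw, h⟩
          have h' := h _ he
          simp only [Sym2.mem_iff, not_or] at h'
          exact ⟨⟨h'.2, h'.1, hw⟩, fun e he' => h e he'.2⟩
        · rintro ⟨⟨hwi, hwv, hw⟩, h⟩
          refine ⟨hw, fun e he' hwe => ?_⟩
          by_cases hev : e = s(v, i)
          · subst hev
            rcases Sym2.mem_iff.1 hwe with h | h
            · exact hwv h
            · exact hwi h
          · exact h e ⟨hev, he'⟩ hwe
      rw [hs, hc, pow_succ]
      ring
  rw [sub_eq_add_neg, ← Finset.sum_neg_distrib, ← Finset.sum_congr rfl key3, ← key2, ← key1]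
  unfold Q
  rw [Finset.sum_filter_add_sum_filter_not]

theorem Q_map {R' : Type*} [CommRing R'] (φ : R →+* R') (S : Finset V) (x : V → R) :
    φ (Q G S x) = Q G S (fun v => φ (x v)) := by
  simp [Q, map_sum, map_mul, map_prod]

open Classical in
theorem Q_congr (S : Finset V) (x y : V → R) (h : ∀ v ∈ S, x v = y v) : Q G S x = Q G S y := by
  unfold Q
  refine Finset.sum_congr rfl fun M _ => ?_
  congr 1
  exact Finset.prod_congr rfl fun v hv => h v (Finset.mem_filter.1 hv).1

open Classical in
theorem Q_shift (S : Finset V) (x : V → R) (a : V) (ha : a ∈ S) (y : R) :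
    Q G S (Function.update x a (x a + y)) = Q G S x + y * Q G (S.erase a) x := by
  have h0 : ∀ T : Finset V, a ∉ T → Q G T (Function.update x a (x a + y)) = Q G T x := by
    intro T hT
    apply Q_congr
    intro v hv
    rw [Function.update_of_ne]
    rintro rfl
    exact hT hv
  rw [Q_rec G S _ a ha, Q_rec G S x a ha, h0 _ (by simp)]
  rw [Finset.sum_congr rfl (fun i _ => h0 ((S.erase a).erase i) (by simp))]
  simp
  ring

end

open Classical in
theorem stable {V : Type*} [Fintype V] (G : SimpleGraph V) (x : V → ℂ) (hx : ∀ v, 0 < (x v).im) :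
    ∀ n, ∀ S : Finset V, S.card = n → Q G S x ≠ 0 ∧
      ∀ v ∈ S, 0 < (Q G S x / Q G (S.erase v) x).im := by
  intro n
  induction n with
  | zero =>
    intro S hS
    rw [Finset.card_eq_zero] at hS
    subst hS
    simp [Q_empty]
  | succ n ih =>
    intro S hS
    have h2 : ∀ v ∈ S, 0 < (Q G S x / Q G (S.erase v) x).im := by
      intro v hv
      have hc : (S.erase v).card = n := by rw [Finset.card_erase_of_mem hv]; omega
      obtain ⟨h0, h1⟩ := ih _ hc
      rw [Q_rec G S x v hv, sub_div, mul_div_cancel_right₀ _ h0, Finset.sum_div, Complex.sub_im,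
        Complex.im_sum]
      have : ∑ i ∈ (S.erase v).filter (fun i => G.Adj v i),
          (Q G ((S.erase v).erase i) x / Q G (S.erase v) x).im ≤ 0 := by
        apply Finset.sum_nonpos
        intro i hi
        have := h1 i (Finset.mem_filter.1 hi).1
        rw [← inv_div, Complex.inv_im]
        apply div_nonpos_of_nonpos_of_nonneg
        · linarith
        · exact Complex.normSq_nonneg _
      linarith [hx v]
    refine ⟨?_, h2⟩
    obtain ⟨v, hv⟩ : S.Nonempty := by rw [← Finset.card_pos]; omega
    intro h
    have := h2 v hv
    rw [h] at this
    simp at this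


open Classical in
theorem Q_embed {W V R : Type*} [Fintype W] [Fintype V] [CommRing R] (H : SimpleGraph W)
    (G : SimpleGraph V) (f : W ↪ V) (hf : ∀ a b, H.Adj a b ↔ G.Adj (f a) (f b)) (x : V → R) :
    ∀ n, ∀ T : Finset W, T.card = n → Q H T (fun w => x (f w)) = Q G (T.map f) x := by
  intro n
  induction n using Nat.strong_induction_on with
  | _ n ih =>
    intro T hT
    rcases T.eq_empty_or_nonempty with rfl | ⟨v, hv⟩
    · simp [Q_empty]
    · have hlt : (T.erase v).card < n := by
        rw [← hT]; exact Finset.card_erase_lt_of_mem hv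
      rw [Q_rec H T _ v hv, Q_rec G (T.map f) x (f v) (by simpa using hv), ← Finset.map_erase,
        ih _ hlt _ rfl]
      congr 1
      have : ((T.erase v).map f).filter (fun i => G.Adj (f v) i)
          = ((T.erase v).filter (fun i => H.Adj v i)).map f := by
        rw [Finset.filter_map]
        congr 1
        apply Finset.filter_congr
        intro i _
        exact (hf v i).symm
      rw [this, Finset.sum_map]
      apply Finset.sum_congr rfl
      intro i _
      rw [← Finset.map_erase]
      exact ih _ (lt_of_le_of_lt (Finset.card_le_card (Finset.erase_subset _ _)) hlt) _ rfl

theorem matchingPolynomial_eq {W : Type*} [Fintype W] (H : SimpleGraph W) :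
    matchingPolynomial H = Q H Finset.univ (fun _ => (X : ℝ[X])) := by
  classical
  unfold matchingPolynomial Q
  apply Finset.sum_congr
  · ext M
    simp [IsMat]
  · intro M hM
    simp only [Finset.mem_filter, Finset.mem_univ, true_and] at hM
    rw [Finset.prod_const]
    congr 2
    have hcov : (M.biUnion (fun e => e.toFinset)).card = 2 * M.card := by
      rw [Finset.card_biUnion]
      · rw [Finset.sum_congr rfl (g := fun _ => 2)]
        · simp [mul_comm]
        · intro e he
          apply Sym2.card_toFinset_of_not_isDiag
          exact H.not_isDiag_of_mem_edgeSet (hM.1 e he).1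
      · intro e he f hf hef
        rw [Function.onFun, Finset.disjoint_left]
        intro v hv hv'
        rw [Sym2.mem_toFinset] at hv hv'
        exact hM.2 e he f hf hef v hv hv'
    have : Finset.univ.filter (fun v => ∀ e ∈ M, v ∉ e)
        = (M.biUnion (fun e => e.toFinset))ᶜ := by
      ext v
      simp
    rw [this, Finset.card_compl, hcov, Nat.card_eq_fintype_card]

section
variable {V : Type*} [Fintype V] (G : SimpleGraph V) (θ : ℝ)

/-- matching polynomial of `G[S]`. -/
noncomputable def pp (S : Finset V) : ℝ[X] := Q G S (fun _ => X)

/-- multiplicity of `θ` in `G[S]`. -/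
noncomputable def mu (S : Finset V) : ℕ := (pp G S).rootMultiplicity θ

theorem matchMult_eq {W : Type*} [Finite W] (H : SimpleGraph W) (f : W ↪ V)
    (hf : ∀ a b, H.Adj a b ↔ G.Adj (f a) (f b)) (S : Finset V) (hS : ∀ v, v ∈ S ↔ ∃ w, f w = v) :
    matchMult θ H = mu G θ S := by
  classical
  have : Fintype W := Fintype.ofFinite W
  unfold matchMult mu pp
  rw [matchingPolynomial_eq, Q_embed H G f hf (fun _ => (X : ℝ[X])) _ _ rfl]
  congr 2
  ext v
  simp [hS]

theorem aeval_pp (S : Finset V) (z : ℂ) : Q G S (fun _ => z) = aeval z (pp G S) := by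
  have := Q_map G (aeval z : ℝ[X] →ₐ[ℝ] ℂ).toRingHom S (fun _ => (X : ℝ[X]))
  simp at this
  rw [pp, this]

theorem pp_ne (S : Finset V) : pp G S ≠ 0 := by
  intro h
  have := (stable G (fun _ => Complex.I) (by simp) _ S rfl).1
  rw [aeval_pp, h] at this
  simp at this

theorem fac (S : Finset V) (k : ℕ) (hk : k ≤ mu G θ S) :
    ∃ r : ℝ[X], pp G S = (X - C θ) ^ k * r ∧ (r.eval θ ≠ 0 ↔ mu G θ S = k) ∧
      ∀ z : ℂ, Q G S (fun _ => z) = (z - θ) ^ k * aeval z r := by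
  obtain ⟨r, hr⟩ := (le_rootMultiplicity_iff (pp_ne G S)).1 hk
  refine ⟨r, hr, ?_, ?_⟩
  · have hne := pp_ne G S
    have hr0 : r ≠ 0 := by
      rintro rfl
      exact hne (by simpa using hr)
    have h1 : mu G θ S = k + r.rootMultiplicity θ := by
      unfold mu
      rw [hr, rootMultiplicity_mul (by rw [← hr]; exact hne), rootMultiplicity_X_sub_C_pow]
    have h2 := rootMultiplicity_pos (p := r) hr0 (x := θ)
    rw [IsRoot.def] at h2
    rw [Ne, ← h2]
    omega
  · intro z
    rw [aeval_pp, hr]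
    simp

theorem aeval_real (r : ℝ[X]) (θ : ℝ) : aeval (θ : ℂ) r = ((r.eval θ : ℝ) : ℂ) := by
  simpa using aeval_algebraMap_apply ℂ θ r

theorem lim (P D r s : ℂ → ℂ) (a b : ℕ) (hP : ∀ z, P z = (z - θ) ^ a * r z)
    (hD : ∀ z, D z = (z - θ) ^ b * s z) (hr : Continuous r) (hs : Continuous s)
    (h : ∀ z : ℂ, 0 < z.im → 0 < (P z / D z).im) (z : ℂ) (hz : 0 < z.im) :
    0 ≤ (z ^ a * r θ * star (z ^ b * s θ)).im := by
  let g : ℝ → ℝ := fun ε => (z ^ a * r (θ + ε * z) * star (z ^ b * s (θ + ε * z))).im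
  have hg : Continuous g := by
    dsimp only [g]
    fun_prop
  have ht : Filter.Tendsto g (nhdsWithin 0 (Set.Ioi 0)) (nhds (g 0)) :=
    (hg.tendsto 0).mono_left nhdsWithin_le_nhds
  have h0 : g 0 = (z ^ a * r θ * star (z ^ b * s θ)).im := by simp [g]
  rw [← h0]
  refine ge_of_tendsto ht ?_
  filter_upwards [self_mem_nhdsWithin] with ε hε
  have hε : 0 < ε := hε
  have h1 := h (θ + ε * z) (by simpa using mul_pos hε hz)
  rw [hP, hD] at h1
  have e1 : ((θ : ℂ) + ε * z - θ) = ε * z := by ring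
  rw [e1] at h1
  set A := r (θ + ε * z) with hA
  set B := s (θ + ε * z) with hB
  have h2 : 0 < ((((ε : ℂ) * z) ^ a * A) * star ((((ε : ℂ) * z) ^ b * B))).im := by
    have hd : ∀ p q : ℂ, 0 < (p / q).im → 0 < (p * star q).im := by
      intro p q hpq
      have hq : q ≠ 0 := by
        rintro rfl
        simp at hpq
      have : (p * star q) = (p / q) * (Complex.normSq q : ℂ) := by
        rw [← Complex.mul_conj, Complex.star_def]
        field_simp
      rw [this, Complex.im_mul_ofReal]
      exact mul_pos hpq (Complex.normSq_pos.2 hq)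
    exact hd _ _ h1
  have h3 : ((((ε : ℂ) * z) ^ a * A) * star ((((ε : ℂ) * z) ^ b * B)))
      = ((ε ^ (a + b) : ℝ) : ℂ) * (z ^ a * A * star (z ^ b * B)) := by
    simp only [star_mul', star_pow, Complex.star_def, Complex.conj_ofReal]
    push_cast
    ring
  rw [h3, Complex.im_ofReal_mul] at h2
  exact le_of_lt ((mul_pos_iff_of_pos_left (by positivity)).1 h2)

theorem lim1 (P D r s : ℂ → ℂ) (b : ℕ) (hP : ∀ z, P z = (z - θ) ^ (b + 1) * r z)
    (hD : ∀ z, D z = (z - θ) ^ b * s z) (hr : Continuous r) (hs : Continuous s)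
    (h : ∀ z : ℂ, 0 < z.im → 0 < (P z / D z).im) (z : ℂ) (hz : 0 < z.im) :
    0 ≤ (z * r θ * star (s θ)).im := by
  have h1 := lim θ P D r s (b + 1) b hP hD hr hs h z hz
  have h2 : z ^ (b + 1) * r θ * star (z ^ b * s θ)
      = ((Complex.normSq z ^ b : ℝ) : ℂ) * (z * r θ * star (s θ)) := by
    push_cast
    rw [← Complex.mul_conj]
    simp only [star_mul', star_pow, Complex.star_def]
    ring
  rw [h2, Complex.im_ofReal_mul] at h1
  have hz0 : z ≠ 0 := by rintro rfl; simp at hz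
  exact (mul_nonneg_iff_of_pos_left (pow_pos (Complex.normSq_pos.2 hz0) b)).1 h1

theorem powsign (c : ℝ) (d : ℕ) (hd : 2 ≤ d)
    (h : ∀ z : ℂ, 0 < z.im → 0 ≤ (z ^ d * c).im) : c = 0 := by
  have hd' : (2 : ℝ) ≤ d := by exact_mod_cast hd
  have hd0 : (d : ℂ) ≠ 0 := by
    norm_cast
    omega
  have hpi := Real.pi_pos
  have key : ∀ t : ℝ, 0 < t → t < 2 → 0 ≤ (Complex.exp ((t * Real.pi : ℝ) * Complex.I) * c).im := by
    intro t h0 h2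
    have h3 := h (Complex.exp ((t * Real.pi / d : ℝ) * Complex.I)) (by
      rw [Complex.exp_ofReal_mul_I_im]
      apply Real.sin_pos_of_pos_of_lt_pi
      · positivity
      · rw [div_lt_iff₀ (by linarith)]
        nlinarith)
    rw [← Complex.exp_nat_mul] at h3
    convert h3 using 4
    push_cast
    field_simp
  have h1 := key (1 / 2) (by norm_num) (by norm_num)
  have h2 := key (3 / 2) (by norm_num) (by norm_num)
  rw [Complex.im_mul_ofReal, Complex.exp_ofReal_mul_I_im] at h1 h2
  have e1 : Real.sin (1 / 2 * Real.pi) = 1 := by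
    rw [show 1 / 2 * Real.pi = Real.pi / 2 by ring, Real.sin_pi_div_two]
  have e2 : Real.sin (3 / 2 * Real.pi) = -1 := by
    rw [show 3 / 2 * Real.pi = Real.pi / 2 + Real.pi by ring, Real.sin_add_pi, Real.sin_pi_div_two]
  rw [e1] at h1
  rw [e2] at h2
  linarith

theorem noncontra (c : ℝ) (hc : c ≠ 0)
    (h : ∀ z : ℂ, 0 < z.im → 0 ≤ (z * (c * Complex.I)).im) : False := by
  have h1 := h (1 + Complex.I) (by simp)
  have h2 := h (-1 + Complex.I) (by simp)
  simp at h1 h2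
  exact hc (le_antisymm h2 h1)

variable [DecidableEq V]

theorem stable1 (S : Finset V) (v : V) (hv : v ∈ S) (x : V → ℂ) (hx : ∀ v, 0 < (x v).im) :
    0 < (Q G S x / Q G (S.erase v) x).im := by
  have := (stable G x hx _ S rfl).2 v hv
  convert this

theorem inter_aux (S : Finset V) (v : V) (hv : v ∈ S) :
    ∃ c : ℝ, c ≠ 0 ∧ ∀ z : ℂ, 0 < z.im →
      0 ≤ (z ^ mu G θ S * star (z ^ mu G θ (S.erase v)) * c).im := by
  obtain ⟨r, -, hr, hr'⟩ := fac G θ S _ le_rfl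
  obtain ⟨s, -, hs, hs'⟩ := fac G θ (S.erase v) _ le_rfl
  refine ⟨r.eval θ * s.eval θ, mul_ne_zero (hr.2 rfl) (hs.2 rfl), fun z hz => ?_⟩
  have := lim θ _ _ (fun z => aeval z r) (fun z => aeval z s) _ _ hr' hs'
    (Polynomial.continuous_aeval r) (Polynomial.continuous_aeval s)
    (fun z hz => stable1 G S v hv (fun _ => z) (fun _ => hz)) z hz
  convert this using 2
  simp only [aeval_real, star_mul', Complex.star_def, Complex.conj_ofReal]
  push_cast
  ring

theorem inter_lo (S : Finset V) (v : V) (hv : v ∈ S) : mu G θ S ≤ mu G θ (S.erase v) + 1 := by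
  obtain ⟨c, hc, h⟩ := inter_aux G θ S v hv
  by_contra hlt
  obtain ⟨d, hd⟩ : ∃ d, mu G θ S = mu G θ (S.erase v) + d := ⟨_, (Nat.add_sub_of_le (by omega)).symm⟩
  apply hc
  apply powsign c d (by omega)
  intro z hz
  have h1 := h z hz
  rw [hd] at h1
  set b := mu G θ (S.erase v)
  have h2 : z ^ (b + d) * star (z ^ b) * c = ((Complex.normSq z ^ b : ℝ) : ℂ) * (z ^ d * c) := by
    push_cast
    rw [← Complex.mul_conj]
    simp only [star_pow, Complex.star_def]
    ring
  rw [h2, Complex.im_ofReal_mul] at h1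
  have hz0 : z ≠ 0 := by rintro rfl; simp at hz
  exact (mul_nonneg_iff_of_pos_left (pow_pos (Complex.normSq_pos.2 hz0) b)).1 h1

theorem inter_hi (S : Finset V) (v : V) (hv : v ∈ S) : mu G θ (S.erase v) ≤ mu G θ S + 1 := by
  obtain ⟨c, hc, h⟩ := inter_aux G θ S v hv
  by_contra hlt
  obtain ⟨d, hd⟩ : ∃ d, mu G θ (S.erase v) = mu G θ S + d := ⟨_, (Nat.add_sub_of_le (by omega)).symm⟩
  apply hc
  suffices -c = 0 by linarith
  apply powsign (-c) d (by omega)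
  intro z hz
  have h1 := h z hz
  rw [hd] at h1
  set b := mu G θ S
  have h2 : z ^ b * star (z ^ (b + d)) * c = ((Complex.normSq z ^ b : ℝ) : ℂ) * star (z ^ d * c) := by
    push_cast
    rw [← Complex.mul_conj]
    simp only [star_mul', star_pow, Complex.star_def, Complex.conj_ofReal]
    ring
  rw [h2, Complex.im_ofReal_mul] at h1
  have hz0 : z ≠ 0 := by rintro rfl; simp at hz
  have := (mul_nonneg_iff_of_pos_left (pow_pos (Complex.normSq_pos.2 hz0) b)).1 h1
  rw [Complex.star_def, Complex.conj_im] at this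
  simpa using this

theorem recur (S : Finset V) (a w : V) (ha : a ∈ S) (hw : w ∈ S) (hadj : G.Adj a w)
    (h : mu G θ ((S.erase a).erase w) + 1 = mu G θ (S.erase a)) :
    mu G θ S + 1 = mu G θ (S.erase a) := by
  set j := mu G θ ((S.erase a).erase w) with hj
  obtain ⟨q, hq, hq0, hq'⟩ := fac G θ (S.erase a) (j + 1) h.le
  have hq0 := hq0.2 h.symm
  have hall : ∀ i : V, ∃ r : ℝ[X], i ∈ S.erase a →
      (pp G ((S.erase a).erase i) = (X - C θ) ^ j * r ∧
        (r.eval θ ≠ 0 ↔ mu G θ ((S.erase a).erase i) = j) ∧ 0 ≤ q.eval θ * r.eval θ) := by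
    intro i
    by_cases hi : i ∈ S.erase a
    · have h1 := inter_lo G θ (S.erase a) i hi
      obtain ⟨r, hr, hr0, hr'⟩ := fac G θ ((S.erase a).erase i) j (by omega)
      refine ⟨r, fun _ => ⟨hr, hr0, ?_⟩⟩
      have := lim1 θ _ _ (fun z => aeval z q) (fun z => aeval z r) _ hq' hr'
        (Polynomial.continuous_aeval q) (Polynomial.continuous_aeval r)
        (fun z hz => stable1 G _ i hi (fun _ => z) (fun _ => hz)) Complex.I (by simp)
      simpa [aeval_real] using this
    · exact ⟨0, fun h => absurd h hi⟩
  choose r hr using hall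
  obtain ⟨N, hN, hrec⟩ : ∃ N : Finset V, (∀ i, i ∈ N ↔ i ∈ S.erase a ∧ G.Adj a i) ∧
      pp G S = X * pp G (S.erase a) - ∑ i ∈ N, pp G ((S.erase a).erase i) := by
    classical
    refine ⟨(S.erase a).filter (fun i => G.Adj a i), fun i => Finset.mem_filter, ?_⟩
    have := Q_rec G S (fun _ => (X : ℝ[X])) a ha
    unfold pp
    convert this
  have hN' : ∀ i ∈ N, i ∈ S.erase a := fun i hi => ((hN i).1 hi).1
  have hrec2 : pp G S = (X - C θ) ^ j * (X * ((X - C θ) * q) - ∑ i ∈ N, r i) := by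
    rw [hrec, hq, Finset.sum_congr rfl (fun i hi => (hr i (hN' i hi)).1), ← Finset.mul_sum]
    ring
  have hwS : w ∈ S.erase a := by simp [hw, hadj.ne']
  have hsum : 0 < ∑ i ∈ N, q.eval θ * (r i).eval θ := by
    apply Finset.sum_pos' (fun i hi => (hr i (hN' i hi)).2.2)
    refine ⟨w, (hN w).2 ⟨hwS, hadj⟩, ?_⟩
    exact lt_of_le_of_ne (hr w hwS).2.2 (mul_ne_zero hq0 ((hr w hwS).2.1.2 rfl)).symm
  have hle : j ≤ mu G θ S := (le_rootMultiplicity_iff (pp_ne G S)).2 ⟨_, hrec2⟩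
  obtain ⟨r', hr', hr0, -⟩ := fac G θ S j hle
  have heq : r' = X * ((X - C θ) * q) - ∑ i ∈ N, r i := by
    rw [hr'] at hrec2
    exact mul_left_cancel₀ (pow_ne_zero _ (X_sub_C_ne_zero θ)) hrec2
  have : mu G θ S = j := by
    apply hr0.1
    rw [heq]
    simp only [eval_sub, eval_mul, eval_X, eval_C, sub_self, zero_mul, mul_zero, zero_sub,
      eval_finset_sum]
    rw [← Finset.mul_sum] at hsum
    intro h
    rw [neg_eq_zero.1 h] at hsum
    simp at hsum
  omega

theorem L2 (S : Finset V) (a w : V) (ha : a ∈ S) (hw : w ∈ S) (haw : a ≠ w) (j : ℕ)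
    (h0 : mu G θ S = j + 1) (h1 : mu G θ (S.erase w) = j) (h2 : mu G θ (S.erase a) = j + 1) :
    mu G θ ((S.erase a).erase w) = j := by
  by_contra hne
  have hge : j + 1 ≤ mu G θ ((S.erase w).erase a) := by
    rw [Finset.erase_right_comm]
    have := inter_lo G θ (S.erase a) w (by simp [hw, haw.symm])
    omega
  obtain ⟨r0, -, hr0, hr0'⟩ := fac G θ S (j + 1) h0.ge
  obtain ⟨r1, -, hr1, hr1'⟩ := fac G θ (S.erase a) (j + 1) h2.ge
  obtain ⟨s0, -, hs0, hs0'⟩ := fac G θ (S.erase w) j h1.ge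
  obtain ⟨s1, -, -, hs1'⟩ := fac G θ ((S.erase w).erase a) (j + 1) hge
  have hr0 := hr0.2 h0
  have hr1 := hr1.2 h2
  have hs0 := hs0.2 h1
  set α := r0.eval θ
  set β := r1.eval θ
  set γ := s0.eval θ
  let y : ℂ := ((-α / β : ℝ) : ℂ) + Complex.I
  have hy : y.im = 1 := by simp [y]
  apply noncontra (β * γ) (mul_ne_zero hr1 hs0)
  intro z hz
  have := lim1 θ (fun z => Q G S (fun _ => z) + y * Q G (S.erase a) (fun _ => z))
    (fun z => Q G (S.erase w) (fun _ => z) + y * Q G ((S.erase w).erase a) (fun _ => z))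
    (fun z => aeval z r0 + y * aeval z r1) (fun z => aeval z s0 + y * ((z - θ) * aeval z s1)) j
    (fun z => by rw [hr0', hr1']; ring)
    (fun z => by rw [hs0', hs1']; ring)
    (by fun_prop) (by fun_prop)
    (fun z hz => by
      have h := stable1 G S w hw (Function.update (fun _ => z) a (z + y)) (by
        intro v
        by_cases hv : v = a
        · subst hv; simp [hy]; linarith
        · simp [hv, hz])
      have e1 := Q_shift G S (fun _ => z) a ha y
      have e2 := Q_shift G (S.erase w) (fun _ => z) a (by simp [ha, haw]) y
      convert h using 3
      · convert e1.symm
      · convert e2.symm) z hz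
  have e : (aeval (θ : ℂ) r0 + y * aeval (θ : ℂ) r1) = β * Complex.I := by
    rw [aeval_real, aeval_real]
    change (α : ℂ) + y * β = _
    have : (β : ℂ) ≠ 0 := by exact_mod_cast hr1
    simp only [y]
    push_cast
    field_simp
    ring
  simp only [e] at this
  convert this using 2
  simp [aeval_real]
  ring

theorem SP (S : Finset V) (a w : V) (ha : a ∈ S) (hw : w ∈ S) (hadj : G.Adj a w)
    (h1 : mu G θ (S.erase w) + 1 = mu G θ S) : mu G θ (S.erase a) ≠ mu G θ S := by
  intro h
  have := L2 G θ S a w ha hw hadj.ne _ h1.symm rfl (by omega)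
  have := recur G θ S a w ha hw hadj (by omega)
  omega

theorem L3 (S : Finset V) (a u w : V) (ha : a ∈ S) (hu : u ∈ S) (hw : w ∈ S) (haw : a ≠ w)
    (hau : a ≠ u) (huw : u ≠ w) (j : ℕ)
    (h0 : mu G θ S = j + 1) (hw1 : mu G θ (S.erase w) = j) (ha1 : j + 2 ≤ mu G θ (S.erase a))
    (hu1 : j + 2 ≤ mu G θ (S.erase u)) (hau1 : mu G θ ((S.erase a).erase u) = j + 1)
    (hwau : j + 1 ≤ mu G θ (((S.erase w).erase a).erase u)) : False := by
  have hwa : j + 1 ≤ mu G θ ((S.erase w).erase a) := by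
    rw [Finset.erase_right_comm]
    have := inter_lo G θ (S.erase a) w (by simp [hw, haw.symm])
    omega
  have hwu : j + 1 ≤ mu G θ ((S.erase w).erase u) := by
    rw [Finset.erase_right_comm]
    have := inter_lo G θ (S.erase u) w (by simp [hw, huw.symm])
    omega
  obtain ⟨r0, -, hr0, hr0'⟩ := fac G θ S (j + 1) h0.ge
  obtain ⟨ra, -, -, hra'⟩ := fac G θ (S.erase a) (j + 2) ha1
  obtain ⟨ru, -, -, hru'⟩ := fac G θ (S.erase u) (j + 2) hu1
  obtain ⟨r1, -, hr1, hr1'⟩ := fac G θ ((S.erase a).erase u) (j + 1) hau1.ge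
  obtain ⟨s0, -, hs0, hs0'⟩ := fac G θ (S.erase w) j hw1.ge
  obtain ⟨sa, -, -, hsa'⟩ := fac G θ ((S.erase w).erase a) (j + 1) hwa
  obtain ⟨su, -, -, hsu'⟩ := fac G θ ((S.erase w).erase u) (j + 1) hwu
  obtain ⟨s1, -, -, hs1'⟩ := fac G θ (((S.erase w).erase a).erase u) (j + 1) hwau
  have hr0 := hr0.2 h0
  have hr1 := hr1.2 hau1
  have hs0 := hs0.2 hw1
  set α := r0.eval θ
  set β := r1.eval θ
  set γ := s0.eval θ
  let t : ℝ := α / β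
  let q : ℝ := 1 + |t|
  let p : ℝ := q - t
  have hq : 0 < q := by positivity
  have hp : 0 < p := by
    have := le_abs_self t
    simp only [p, q]
    linarith
  let y : ℂ := 1 + Complex.I
  let x : ℂ := p + q * Complex.I
  have hy : y.im = 1 := by simp [y]
  have hx : x.im = q := by simp [x]
  have hyx : α + y * x * β = (β * (p + q) : ℝ) * Complex.I := by
    have hb : (β : ℂ) ≠ 0 := by exact_mod_cast hr1
    have ht : (α : ℂ) = t * β := by
      simp only [t]
      push_cast
      field_simp
    have hp' : (p : ℂ) = q - t := by simp [p]
    rw [ht]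
    simp only [y, x]
    push_cast
    rw [hp']
    linear_combination (q * β : ℂ) * Complex.I_sq
  apply noncontra (β * (p + q) * γ) (mul_ne_zero (mul_ne_zero hr1 (by positivity)) hs0)
  intro z hz
  have := lim1 θ (fun z => (Q G S (fun _ => z) + x * Q G (S.erase u) (fun _ => z))
      + y * (Q G (S.erase a) (fun _ => z) + x * Q G ((S.erase a).erase u) (fun _ => z)))
    (fun z => (Q G (S.erase w) (fun _ => z) + x * Q G ((S.erase w).erase u) (fun _ => z))
      + y * (Q G ((S.erase w).erase a) (fun _ => z)
        + x * Q G (((S.erase w).erase a).erase u) (fun _ => z)))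
    (fun z => aeval z r0 + x * ((z - θ) * aeval z ru) + y * ((z - θ) * aeval z ra + x * aeval z r1))
    (fun z => aeval z s0 + x * ((z - θ) * aeval z su)
      + y * ((z - θ) * aeval z sa + x * ((z - θ) * aeval z s1))) j
    (fun z => by rw [hr0', hr1', hra', hru']; ring)
    (fun z => by rw [hs0', hs1', hsa', hsu']; ring)
    (by fun_prop) (by fun_prop)
    (fun z hz => by
      let f : V → ℂ := Function.update (fun _ => z) u (z + x)
      have hfa : f a = z := by simp [f, hau]
      have h := stable1 G S w hw (Function.update f a (f a + y)) (by
        intro v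
        by_cases hv : v = a
        · subst hv; simp [hy, hfa]; linarith
        · by_cases hv' : v = u
          · subst hv'; simp [hv, f, hx]; linarith
          · simp [hv, hv', f, hz])
      have hs : ∀ T : Finset V, u ∈ T → Q G T f
          = Q G T (fun _ => z) + x * Q G (T.erase u) (fun _ => z) := by
        intro T hT
        have := Q_shift G T (fun _ => z) u hT x
        convert this
      have hs' : ∀ T : Finset V, a ∈ T → Q G T (Function.update f a (f a + y))
          = Q G T f + y * Q G (T.erase a) f := by
        intro T hT
        have := Q_shift G T f a hT y
        convert this
      rw [hs' S ha, hs' (S.erase w) (by simp [ha, haw]), hs S hu, hs _ (by simp [hu, hau.symm]),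
        hs _ (by simp [hu, huw]), hs _ (by simp [hu, huw, hau.symm])] at h
      exact h) z hz
  have e : (aeval (θ : ℂ) r0 + x * ((θ - θ) * aeval (θ : ℂ) ru)
      + y * ((θ - θ) * aeval (θ : ℂ) ra + x * aeval (θ : ℂ) r1)) = (β * (p + q) : ℝ) * Complex.I := by
    rw [← hyx, aeval_real r0, aeval_real r1]
    ring
  simp only [e] at this
  convert this using 2
  simp [aeval_real]
  ring

theorem main (S : Finset V) (a u w : V) (ha : a ∈ S) (hu : u ∈ S) (hw : w ∈ S) (hau : a ≠ u)
    (hadj : G.Adj a w) (hw1 : mu G θ (S.erase w) + 1 = mu G θ S)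
    (ha1 : mu G θ (S.erase a) + 1 ≠ mu G θ S) (hu1 : mu G θ (S.erase u) + 1 ≠ mu G θ S) :
    mu G θ ((S.erase a).erase u) + 1 ≠ mu G θ (S.erase a) := by
  intro h
  have huw : u ≠ w := by
    rintro rfl
    exact hu1 hw1
  have haw := hadj.ne
  have i1 := inter_lo G θ S a ha
  have i2 := inter_hi G θ S a ha
  have i3 := inter_lo G θ S u hu
  have i4 := inter_hi G θ S u hu
  have i5 := SP G θ S a w ha hw hadj hw1
  have hwu : w ∈ S.erase u := by simp [hw, huw.symm]
  have hau' : a ∈ S.erase u := by simp [ha, hau]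
  by_cases hn : mu G θ (S.erase u) = mu G θ S
  · have j1 := L2 G θ S u w hu hw huw _ hw1.symm rfl (by omega)
    have j2 := SP G θ (S.erase u) a w hau' hwu hadj (by omega)
    rw [Finset.erase_right_comm] at j2
    omega
  · apply L3 G θ S a u w ha hu hw haw hau huw _ hw1.symm rfl (by omega) (by omega) (by omega)
    by_contra hlt
    have e1 : ((S.erase w).erase a).erase u = ((S.erase a).erase u).erase w := by
      rw [Finset.erase_right_comm (a := w), Finset.erase_right_comm (a := w)]
    have e2 : (S.erase a).erase u = (S.erase u).erase a := Finset.erase_right_comm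
    rw [e1] at hlt
    have j1 := inter_lo G θ ((S.erase a).erase u) w (by simp [hw, huw.symm, haw.symm])
    have j2 := recur G θ (S.erase u) a w hau' hwu hadj (by rw [← e2]; omega)
    rw [← e2] at j2
    omega

end

end MatchAux

-- statement 14
theorem nonessential_stable_under_deleting_special {V : Type*} [Finite V] (θ : ℝ)
    (G : SimpleGraph V) (a : V) (ha : IsSpecial θ G a)
    (u : V) (hu : u ≠ a) (h : ¬ IsEssential θ G u) :
    ¬ IsEssential θ (G.induce {v | v ≠ a}) ⟨u, hu⟩ := by
  classical
  have : Fintype V := Fintype.ofFinite V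
  have e0 : matchMult θ G = MatchAux.mu G θ Finset.univ :=
    MatchAux.matchMult_eq G θ G (Function.Embedding.refl V) (by simp) _ (by simp)
  have e1 : ∀ v, matchMult θ (G.induce {x | x ≠ v}) = MatchAux.mu G θ (Finset.univ.erase v) :=
    fun v => MatchAux.matchMult_eq G θ _ (Function.Embedding.subtype _) (by simp) _ (by simp)
  have e2 : matchMult θ ((G.induce {v | v ≠ a}).induce {v | v ≠ ⟨u, hu⟩})
      = MatchAux.mu G θ ((Finset.univ.erase a).erase u) :=
    MatchAux.matchMult_eq G θ _
      ((Function.Embedding.subtype _).trans (Function.Embedding.subtype _)) (by simp) _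
      (by
        intro v
        simp only [Finset.mem_erase, Finset.mem_univ, and_true]
        constructor
        · rintro ⟨h1, h2⟩
          exact ⟨⟨⟨v, h2⟩, fun h => h1 (congrArg Subtype.val h)⟩, rfl⟩
        · rintro ⟨⟨⟨w, h2⟩, h1⟩, rfl⟩
          exact ⟨fun h => h1 (Subtype.ext h), h2⟩)
  obtain ⟨ha1, w, hadj, hw⟩ := ha
  unfold IsEssential at *
  rw [e2, e1]
  rw [e0, e1] at ha1 hw h
  exact MatchAux.main G θ Finset.univ a u w (Finset.mem_univ _) (Finset.mem_univ _)
    (Finset.mem_univ _) hu.symm hadj hw ha1 h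
end

section
/- Let θ ∈ ℝ, let G be a finite simple graph, and let D be the set of θ-essential vertices of G. If u ≠ v are two vertices lying in the same connected component of the induced subgraph G[D], then v is not θ-essential in G−u: mult(θ, (G−u)−v) ≠ mult(θ, G−u) − 1. -/
open Polynomial

open Classical in
/-- vertex recurrence with weights `x` -/
def ECD_Rec {V R : Type*} [CommRing R] (G : SimpleGraph V) (x : V → R) (N : Finset V → R) : Prop :=
  ∀ W : Finset V, ∀ u ∈ W, N W = x u * N (W.erase u) -
    ∑ i ∈ W.erase u, if G.Adj u i then N ((W.erase u).erase i) else 0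

open Classical in
theorem ecd_rayleigh {V : Type*} (G : SimpleGraph V) (x : V → ℝ) (N : Finset V → ℝ)
    (h : ECD_Rec G x N) (n : ℕ) : ∀ W : Finset V, W.card = n → ∀ u ∈ W, ∀ w ∈ W, u ≠ w →
    (if G.Adj u w then N ((W.erase u).erase w) ^ 2 else 0) ≤
      N (W.erase u) * N (W.erase w) - N W * N ((W.erase u).erase w) := by
  induction n with
  | zero => intro W hW u hu; simp_all
  | succ n ih =>
    intro W hW u hu w hw huw
    have hT : (W.erase u).card = n := by rw [Finset.card_erase_of_mem hu]; omega
    have hwT : w ∈ W.erase u := Finset.mem_erase.2 ⟨huw.symm, hw⟩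
    have e1 := h W u hu
    have e2 := h (W.erase w) u (Finset.mem_erase.2 ⟨huw, hu⟩)
    rw [Finset.erase_right_comm (a := w) (b := u)] at e2
    rw [← Finset.add_sum_erase _ _ hwT] at e1
    have key : N (W.erase u) * N (W.erase w) - N W * N ((W.erase u).erase w) =
        (if G.Adj u w then N ((W.erase u).erase w) ^ 2 else 0) +
        ∑ i ∈ (W.erase u).erase w, if G.Adj u i then
          N ((W.erase u).erase i) * N ((W.erase u).erase w) -
            N (W.erase u) * N (((W.erase u).erase i).erase w) else 0 := by
      have : (∑ i ∈ (W.erase u).erase w, if G.Adj u i then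
          N ((W.erase u).erase i) * N ((W.erase u).erase w) -
            N (W.erase u) * N (((W.erase u).erase i).erase w) else 0) =
          (∑ i ∈ (W.erase u).erase w, if G.Adj u i then N ((W.erase u).erase i) else 0)
            * N ((W.erase u).erase w) - N (W.erase u) *
          ∑ i ∈ (W.erase u).erase w, if G.Adj u i then N (((W.erase u).erase w).erase i) else 0 := by
        rw [Finset.sum_mul, Finset.mul_sum, ← Finset.sum_sub_distrib]
        refine Finset.sum_congr rfl fun i _ => ?_
        rw [Finset.erase_right_comm (a := w) (b := i)]
        split_ifs <;> ring
      rw [this, e1, e2]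
      split_ifs <;> ring
    rw [key]
    refine le_add_of_nonneg_right (Finset.sum_nonneg fun i hi => ?_)
    split_ifs with hadj
    · have hi' := Finset.mem_erase.1 hi
      have := ih (W.erase u) hT i hi'.2 w hwT hi'.1
      refine le_trans ?_ this
      split_ifs <;> positivity
    · exact le_rfl

open Classical in
theorem ecd_deriv {V : Type*} (G : SimpleGraph V) (Q : Finset V → ℝ[X])
    (h : ECD_Rec G (fun _ => X) Q) (h0 : Q ∅ = 1) (n : ℕ) : ∀ W : Finset V, W.card = n →
    derivative (Q W) = ∑ j ∈ W, Q (W.erase j) := by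
  induction n using Nat.strong_induction_on with
  | _ n ih =>
    intro W hW
    rcases W.eq_empty_or_nonempty with rfl | ⟨u, hu⟩
    · simp [h0]
    have hT : (W.erase u).card < n := by
      rw [← hW]; exact Finset.card_erase_lt_of_mem hu
    rw [h W u hu, ← Finset.add_sum_erase _ _ hu, derivative_sub, derivative_mul, derivative_X,
      ih _ hT _ rfl, derivative_sum]
    have e : ∀ i ∈ W.erase u, derivative (if G.Adj u i then Q ((W.erase u).erase i) else 0) =
        ∑ j ∈ W.erase u, if j = i then 0 else
          if G.Adj u i then Q (((W.erase u).erase j).erase i) else 0 := by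
      intro i hi
      have hc : ((W.erase u).erase i).card < n :=
        (Finset.card_erase_lt_of_mem hi).trans hT
      rw [← Finset.add_sum_erase _ _ hi, if_pos rfl, zero_add]
      by_cases ha : G.Adj u i
      · simp only [if_pos ha]
        rw [ih _ hc _ rfl]
        refine Finset.sum_congr rfl fun j hj => ?_
        rw [if_neg (Finset.mem_erase.1 hj).1, Finset.erase_right_comm]
      · simp [ha]
    rw [Finset.sum_congr rfl e, Finset.sum_comm, one_mul, Finset.mul_sum, add_sub_assoc,
      ← Finset.sum_sub_distrib]
    congr 1
    refine Finset.sum_congr rfl fun j hj => ?_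
    have hj' := Finset.mem_erase.1 hj
    rw [h (W.erase j) u (Finset.mem_erase.2 ⟨hj'.1.symm, hu⟩)]
    rw [Finset.erase_right_comm (a := j) (b := u)]
    congr 1
    rw [← Finset.add_sum_erase _ _ hj]
    simp only [if_true, zero_add]
    refine Finset.sum_congr rfl fun i hi => ?_
    rw [if_neg (Finset.mem_erase.1 hi).1.symm]

theorem ecd_eval {V : Type*} (G : SimpleGraph V) (Q : Finset V → ℝ[X])
    (h : ECD_Rec G (fun _ => X) Q) (z : ℝ) : ECD_Rec G (fun _ => z) (fun W => (Q W).eval z) := by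
  classical
  intro W u hu
  have := congrArg (Polynomial.eval z) (h W u hu)
  refine this.trans ?_
  simp only [eval_sub, eval_mul, eval_X, eval_finsetSum]
  congr 1
  refine Finset.sum_congr rfl fun i _ => ?_
  split_ifs <;> simp

open Classical in
theorem ecd_shift {V : Type*} (G : SimpleGraph V) (N : Finset V → ℝ) (z s : ℝ) (v : V)
    (h : ECD_Rec G (fun _ => z) N) : ECD_Rec G (fun i => if i = v then z + s else z)
      (fun W => if v ∈ W then N W + s * N (W.erase v) else N W) := by
  intro W u hu
  by_cases hv : v ∈ W
  · by_cases huv : u = v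
    · subst huv
      simp only [hu, if_true, Finset.mem_erase, ne_eq, not_true_eq_false, false_and, if_false,
        and_false]
      have := h W u hu
      rw [this]; ring
    · have hvT : v ∈ W.erase u := Finset.mem_erase.2 ⟨fun e => huv e.symm, hv⟩
      have e1 := h W u hu
      have e2 := h (W.erase v) u (Finset.mem_erase.2 ⟨huv, hu⟩)
      rw [Finset.erase_right_comm (a := v) (b := u)] at e2
      simp only [hv, hvT, if_true, huv, if_false]
      rw [← Finset.add_sum_erase _ _ hvT] at e1 ⊢
      simp only [Finset.mem_erase, ne_eq, not_true_eq_false, false_and, if_false]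
      have : (∑ i ∈ (W.erase u).erase v, if G.Adj u i then
          (if ¬ v = i ∧ ¬ v = u ∧ v ∈ W then N ((W.erase u).erase i) +
            s * N (((W.erase u).erase i).erase v) else N ((W.erase u).erase i)) else 0) =
          (∑ i ∈ (W.erase u).erase v, if G.Adj u i then N ((W.erase u).erase i) else 0) +
          s * ∑ i ∈ (W.erase u).erase v, if G.Adj u i then
            N (((W.erase u).erase v).erase i) else 0 := by
        rw [Finset.mul_sum, ← Finset.sum_add_distrib]
        refine Finset.sum_congr rfl fun i hi => ?_
        have hi' := (Finset.mem_erase.1 hi).1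
        have hc : ¬ v = i ∧ ¬ v = u ∧ v ∈ W := ⟨fun e => hi' e.symm, fun e => huv e.symm, hv⟩
        rw [Finset.erase_right_comm (a := v) (b := i)]
        simp only [if_pos hc]
        split_ifs <;> simp
      rw [this, e1, e2]
      ring
  · have huv : u ≠ v := fun e => hv (e ▸ hu)
    simp only [hv, if_false, huv, Finset.mem_erase, and_false]
    exact h W u hu

/-- If `p² ≤ q` pointwise then order of `q` is at most twice the order of `p`. -/
theorem ecd_order (θ : ℝ) (p q : ℝ[X]) (hp : p ≠ 0) (m : ℕ) (hq : (X - C θ) ^ m ∣ q)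
    (hle : ∀ z : ℝ, p.eval z ^ 2 ≤ q.eval z) : m ≤ 2 * p.rootMultiplicity θ := by
  by_contra! hlt
  obtain ⟨r, hr, hr'⟩ := Polynomial.exists_eq_pow_rootMultiplicity_mul_and_not_dvd p hp θ
  set l := p.rootMultiplicity θ
  obtain ⟨g, rfl⟩ := (pow_dvd_pow (X - C θ) (Nat.succ_le_of_lt hlt)).trans hq
  have hrθ : r.eval θ ≠ 0 := fun h => hr' (dvd_iff_isRoot.2 h)
  have h1 : ∀ z : ℝ, z ∈ ({θ}ᶜ : Set ℝ) → 0 ≤ (z - θ) * g.eval z - r.eval z ^ 2 := by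
    intro z hz
    have hz' : z - θ ≠ 0 := sub_ne_zero.2 hz
    have := hle z
    rw [hr] at this
    simp only [eval_mul, eval_pow, eval_sub, eval_X, eval_C] at this
    have hpos : 0 < (z - θ) ^ (2 * l) := by rw [pow_mul]; positivity
    by_contra! hneg
    have := mul_neg_of_pos_of_neg hpos hneg
    have e : (z - θ) ^ (2 * l) * ((z - θ) * eval z g - eval z r ^ 2) =
      (z - θ) ^ (2 * l).succ * eval z g - ((z - θ) ^ l * eval z r) ^ 2 := by
      rw [Nat.succ_eq_add_one]; ring
    linarith
  have hcl : IsClosed {z : ℝ | 0 ≤ (z - θ) * g.eval z - r.eval z ^ 2} :=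
    isClosed_le continuous_const (by fun_prop)
  have hd : Dense ({θ}ᶜ : Set ℝ) := dense_compl_singleton θ
  have : θ ∈ {z : ℝ | 0 ≤ (z - θ) * g.eval z - r.eval z ^ 2} := by
    have := hcl.closure_subset_iff.2 (fun z hz => h1 z hz)
    exact this (hd θ)
  simp only [Set.mem_ofPred_eq, sub_self, zero_mul, zero_sub] at this
  have : 0 < r.eval θ ^ 2 := by positivity
  linarith

open Classical in
theorem ecd_deriv_ineq {V : Type*} (G : SimpleGraph V) (Q : Finset V → ℝ[X])
    (h : ECD_Rec G (fun _ => X) Q) (h0 : Q ∅ = 1) (W : Finset V) (w : V) (hw : w ∈ W) (z : ℝ) :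
    (Q (W.erase w)).eval z ^ 2 ≤ (derivative (Q W) * Q (W.erase w) -
      Q W * derivative (Q (W.erase w))).eval z := by
  rw [ecd_deriv G Q h h0 _ _ rfl, ecd_deriv G Q h h0 _ _ rfl, ← Finset.add_sum_erase _ _ hw]
  have e : (Q (W.erase w) + ∑ x ∈ W.erase w, Q (W.erase x)) * Q (W.erase w) -
      Q W * ∑ j ∈ W.erase w, Q ((W.erase w).erase j) = Q (W.erase w) ^ 2 +
      ∑ j ∈ W.erase w, (Q (W.erase j) * Q (W.erase w) - Q W * Q ((W.erase j).erase w)) := by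
    rw [Finset.sum_sub_distrib, Finset.mul_sum, add_mul, Finset.sum_mul]
    simp only [Finset.erase_right_comm (a := w)]
    ring
  rw [e, eval_add, eval_pow, eval_finsetSum]
  refine le_add_of_nonneg_right (Finset.sum_nonneg fun j hj => ?_)
  have hj' := Finset.mem_erase.1 hj
  have := ecd_rayleigh G _ _ (ecd_eval G Q h z) _ W rfl j hj'.2 w hw hj'.1
  simp only [eval_sub, eval_mul]
  refine le_trans ?_ this
  split_ifs <;> positivity

open Classical in
theorem ecd_ne_zero {V : Type*} (G : SimpleGraph V) (Q : Finset V → ℝ[X])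
    (h : ECD_Rec G (fun _ => X) Q) (h0 : Q ∅ = 1) (W : Finset V) : Q W ≠ 0 := by
  induction W using Finset.induction_on with
  | empty => simp [h0]
  | insert a s ha ih =>
    intro hz
    apply ih
    refine Polynomial.funext fun z => ?_
    have := ecd_deriv_ineq G Q h h0 (insert a s) a (Finset.mem_insert_self _ _) z
    rw [Finset.erase_insert ha, hz] at this
    simp only [derivative_zero, zero_mul, sub_zero, eval_zero] at this
    simpa using pow_eq_zero_iff (two_ne_zero) |>.1 (le_antisymm this (sq_nonneg _))

open Classical in
theorem ecd_interlace {V : Type*} (G : SimpleGraph V) (Q : Finset V → ℝ[X])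
    (h : ECD_Rec G (fun _ => X) Q) (h0 : Q ∅ = 1) (θ : ℝ) (W : Finset V) (w : V) :
    (Q W).rootMultiplicity θ ≤ (Q (W.erase w)).rootMultiplicity θ + 1 := by
  by_cases hw : w ∈ W
  swap
  · rw [Finset.erase_eq_of_notMem hw]; omega
  by_contra! hlt
  set m := (Q W).rootMultiplicity θ with hm
  set l := (Q (W.erase w)).rootMultiplicity θ with hl
  have d1 : (X - C θ) ^ m ∣ Q W := pow_rootMultiplicity_dvd _ _
  have d2 : (X - C θ) ^ l ∣ Q (W.erase w) := pow_rootMultiplicity_dvd _ _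
  have d3 : (X - C θ) ^ (m - 1) ∣ derivative (Q W) := pow_sub_one_dvd_derivative_of_pow_dvd d1
  have := ecd_order θ (Q (W.erase w)) _ (ecd_ne_zero G Q h h0 _) (2 * l + 1) ?_
    (ecd_deriv_ineq G Q h h0 W w hw)
  · omega
  have d4 : (X - C θ) ^ (l - 1) ∣ derivative (Q (W.erase w)) :=
    pow_sub_one_dvd_derivative_of_pow_dvd d2
  refine dvd_sub ?_ ?_
  · refine (pow_dvd_pow _ ?_).trans ((pow_add (X - C θ) (m-1) l) ▸ mul_dvd_mul d3 d2)
    omega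
  · refine (pow_dvd_pow _ ?_).trans ((pow_add (X - C θ) m (l-1)) ▸ mul_dvd_mul d1 d4)
    omega

theorem ecd_dvd_mul {θ : ℝ} {p q : ℝ[X]} {a b c : ℕ} (hp : a ≤ p.rootMultiplicity θ)
    (hq : b ≤ q.rootMultiplicity θ) (hc : c ≤ a + b) : (X - C θ) ^ c ∣ p * q := by
  refine (pow_dvd_pow _ hc).trans ?_
  rw [pow_add]
  exact mul_dvd_mul ((pow_dvd_pow _ hp).trans (pow_rootMultiplicity_dvd _ _))
    ((pow_dvd_pow _ hq).trans (pow_rootMultiplicity_dvd _ _))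

open Classical in
theorem ecd_adj {V : Type*} (G : SimpleGraph V) (Q : Finset V → ℝ[X])
    (h : ECD_Rec G (fun _ => X) Q) (h0 : Q ∅ = 1) (θ : ℝ) (W : Finset V) (u w : V)
    (hu : u ∈ W) (hw : w ∈ W) (huw : G.Adj u w)
    (mu : (Q (W.erase u)).rootMultiplicity θ + 1 = (Q W).rootMultiplicity θ)
    (mw : (Q (W.erase w)).rootMultiplicity θ + 1 = (Q W).rootMultiplicity θ) :
    (Q W).rootMultiplicity θ ≤ (Q ((W.erase u).erase w)).rootMultiplicity θ + 1 := by
  by_contra! hlt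
  set l := (Q ((W.erase u).erase w)).rootMultiplicity θ with hl
  have := ecd_order θ (Q ((W.erase u).erase w))
    (Q (W.erase u) * Q (W.erase w) - Q W * Q ((W.erase u).erase w))
    (ecd_ne_zero G Q h h0 _) (2 * l + 1) ?_ ?_
  · omega
  · refine dvd_sub (ecd_dvd_mul (le_refl _) (le_refl _) (by omega))
      (ecd_dvd_mul (le_refl _) (le_refl _) (by omega))
  · intro z
    have := ecd_rayleigh G _ _ (ecd_eval G Q h z) _ W rfl u hu w hw huw.ne
    simpa [huw] using this

open Classical in
theorem ecd_trans {V : Type*} (G : SimpleGraph V) (Q : Finset V → ℝ[X])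
    (h : ECD_Rec G (fun _ => X) Q) (h0 : Q ∅ = 1) (θ : ℝ) (W : Finset V) (u v w : V)
    (hu : u ∈ W) (hv : v ∈ W) (hw : w ∈ W)
    (mu : (Q (W.erase u)).rootMultiplicity θ + 1 = (Q W).rootMultiplicity θ)
    (mv : (Q (W.erase v)).rootMultiplicity θ + 1 = (Q W).rootMultiplicity θ)
    (mw : (Q (W.erase w)).rootMultiplicity θ + 1 = (Q W).rootMultiplicity θ)
    (muv : (Q W).rootMultiplicity θ ≤ (Q ((W.erase u).erase v)).rootMultiplicity θ + 1)
    (mvw : (Q W).rootMultiplicity θ ≤ (Q ((W.erase v).erase w)).rootMultiplicity θ + 1) :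
    (Q W).rootMultiplicity θ ≤ (Q ((W.erase u).erase w)).rootMultiplicity θ + 1 := by
  by_cases huv : u = v
  · subst huv; exact mvw
  by_cases hvw : v = w
  · subst hvw; exact muv
  by_cases huw : u = w
  · subst huw
    rw [Finset.erase_idem]; omega
  by_contra! hlt
  have i1 := ecd_interlace G Q h h0 θ ((W.erase u).erase v) w
  have i2 := ecd_interlace G Q h h0 θ (W.erase u) w
  set A := Q (W.erase u) * Q (W.erase w) - Q W * Q ((W.erase u).erase w) with hA
  set D := Q ((W.erase u).erase v) * Q ((W.erase v).erase w) -
    Q (W.erase v) * Q (((W.erase u).erase v).erase w) with hD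
  set B0 := Q (W.erase u) * Q ((W.erase v).erase w) + Q ((W.erase u).erase v) * Q (W.erase w)
    - Q W * Q (((W.erase u).erase v).erase w) with hB0
  set E := Q (W.erase v) * Q ((W.erase u).erase w) with hE
  have nn : ∀ z s : ℝ, 0 ≤ D.eval z * (s * s) + (B0 - E).eval z * s + A.eval z := by
    intro z s
    have := ecd_rayleigh G _ _ (ecd_shift G _ z s v (ecd_eval G Q h z)) _ W rfl u hu w hw huw
    have hvu : ¬ v = u := fun e => huv e.symm
    have h2 := le_trans (by split_ifs <;> positivity) this
    simp only [Finset.mem_erase, hv, ne_eq, hvw, not_false_eq_true, true_and, if_true,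
      hvu, and_self] at h2
    simp only [hA, hD, hB0, hE, eval_sub, eval_mul, eval_add]
    rw [Finset.erase_right_comm (s := W) (a := w) (b := v),
      Finset.erase_right_comm (s := W.erase u) (a := w) (b := v)] at h2
    linarith
  set j := (Q ((W.erase u).erase w)).rootMultiplicity θ with hj
  have dA : (X - C θ) ^ (2 * j + 2) ∣ A :=
    dvd_sub (ecd_dvd_mul le_rfl le_rfl (by omega)) (ecd_dvd_mul le_rfl le_rfl (by omega))
  have dD : (X - C θ) ^ (2 * j + 1) ∣ D :=
    dvd_sub (ecd_dvd_mul le_rfl le_rfl (by omega)) (ecd_dvd_mul le_rfl le_rfl (by omega))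
  have dB0 : (X - C θ) ^ (2 * j + 2) ∣ B0 :=
    dvd_sub (dvd_add (ecd_dvd_mul le_rfl le_rfl (by omega)) (ecd_dvd_mul le_rfl le_rfl (by omega)))
      (ecd_dvd_mul le_rfl le_rfl (by omega))
  have hE0 : E ≠ 0 := mul_ne_zero (ecd_ne_zero G Q h h0 _) (ecd_ne_zero G Q h h0 _)
  have mE : E.rootMultiplicity θ = 2 * j + 1 := by
    rw [hE, rootMultiplicity_mul hE0]; omega
  have hB : (X - C θ) ^ (2 * j + 2) ∣ B0 - E := by
    by_cases hz : B0 - E = 0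
    · rw [hz]; exact dvd_zero _
    have := ecd_order θ (B0 - E) (4 * D * A) hz (4 * j + 3) ?_ ?_
    · exact (pow_dvd_pow _ (by omega)).trans (pow_rootMultiplicity_dvd _ _)
    · rw [mul_assoc]
      refine dvd_mul_of_dvd_right ?_ _
      rw [show 4 * j + 3 = (2 * j + 1) + (2 * j + 2) by ring, pow_add]
      exact mul_dvd_mul dD dA
    · intro z
      have := discrim_le_zero (nn z)
      rw [discrim] at this
      simp only [eval_mul, eval_ofNat] at this ⊢
      linarith
  have : (X - C θ) ^ (2 * j + 2) ∣ E := by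
    have := dvd_sub dB0 hB
    rwa [sub_sub_cancel] at this
  have := (le_rootMultiplicity_iff hE0).2 this
  omega

open Classical in
/-- matchings inside `W` -/
noncomputable def ecdM {V : Type*} [Fintype V] (G : SimpleGraph V) (W : Finset V) :
    Finset (Finset (Sym2 V)) :=
  Finset.univ.filter (fun M => (∀ e ∈ M, e ∈ G.edgeSet ∧ ∀ v ∈ e, v ∈ W) ∧
    ∀ e ∈ M, ∀ f ∈ M, e ≠ f → ∀ v, v ∈ e → v ∉ f)

/-- matching polynomial of the subgraph induced by `W` -/
noncomputable def ecdQ {V : Type*} [Fintype V] (G : SimpleGraph V) (W : Finset V) : ℝ[X] :=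
  ∑ M ∈ ecdM G W, (-1 : ℝ[X]) ^ M.card * X ^ (W.card - 2 * M.card)

theorem mem_ecdM {V : Type*} [Fintype V] {G : SimpleGraph V} {W : Finset V}
    {M : Finset (Sym2 V)} : M ∈ ecdM G W ↔ (∀ e ∈ M, e ∈ G.edgeSet ∧ ∀ v ∈ e, v ∈ W) ∧
    ∀ e ∈ M, ∀ f ∈ M, e ≠ f → ∀ v, v ∈ e → v ∉ f := by
  simp [ecdM]

theorem ecdM_card {V : Type*} [Fintype V] {G : SimpleGraph V} {W : Finset V}
    {M : Finset (Sym2 V)} (hM : M ∈ ecdM G W) : 2 * M.card ≤ W.card := by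
  classical
  obtain ⟨h1, h2⟩ := mem_ecdM.1 hM
  have hd : (M : Set (Sym2 V)).PairwiseDisjoint (fun e => e.toFinset) := by
    intro e he f hf hef
    refine Finset.disjoint_left.2 fun v hv hv' => ?_
    exact h2 e he f hf hef v (Sym2.mem_toFinset.1 hv) (Sym2.mem_toFinset.1 hv')
  have hc := Finset.card_biUnion hd
  rw [Finset.sum_congr rfl (fun e he => Sym2.card_toFinset_of_not_isDiag e
    (G.not_isDiag_of_mem_edgeSet (h1 e he).1)), Finset.sum_const, smul_eq_mul] at hc
  rw [mul_comm, ← hc]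
  refine Finset.card_le_card fun v hv => ?_
  obtain ⟨e, he, hv⟩ := Finset.mem_biUnion.1 hv
  exact (h1 e he).2 v (Sym2.mem_toFinset.1 hv)

theorem ecdQ_empty {V : Type*} [Fintype V] (G : SimpleGraph V) : ecdQ G ∅ = 1 := by
  have : ecdM G ∅ = {∅} := by
    ext M
    constructor
    · intro hM
      have := ecdM_card hM
      simpa using this
    · intro hM
      rw [Finset.mem_singleton.1 hM, mem_ecdM]
      simp
  simp [ecdQ, this]

theorem ecdQ_rec {V : Type*} [Fintype V] (G : SimpleGraph V) :
    ECD_Rec G (fun _ => X) (ecdQ G) := by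
  classical
  intro W u hu
  have hcard : (W.erase u).card + 1 = W.card := Finset.card_erase_add_one hu
  conv_lhs => rw [ecdQ, ← Finset.sum_filter_add_sum_filter_not (ecdM G W) (fun M => ∃ e ∈ M, u ∈ e)]
  rw [add_comm, sub_eq_add_neg]
  congr 1
  · have : (ecdM G W).filter (fun M => ¬ ∃ e ∈ M, u ∈ e) = ecdM G (W.erase u) := by
      ext M
      simp only [Finset.mem_filter, mem_ecdM, Finset.mem_erase]
      constructor
      · rintro ⟨⟨h1, h2⟩, h3⟩
        exact ⟨fun e he => ⟨(h1 e he).1, fun v hv => ⟨fun h => h3 ⟨e, he, h ▸ hv⟩,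
          (h1 e he).2 v hv⟩⟩, h2⟩
      · rintro ⟨h1, h2⟩
        exact ⟨⟨fun e he => ⟨(h1 e he).1, fun v hv => ((h1 e he).2 v hv).2⟩, h2⟩,
          fun ⟨e, he, h⟩ => ((h1 e he).2 u h).1 rfl⟩
    rw [this, ecdQ, Finset.mul_sum]
    refine Finset.sum_congr rfl fun M hM => ?_
    have := ecdM_card hM
    rw [show W.card - 2 * M.card = ((W.erase u).card - 2 * M.card) + 1 by omega, pow_succ]
    ring
  · rw [← Finset.sum_filter, ← Finset.sum_neg_distrib]
    simp only [ecdQ, ← Finset.sum_neg_distrib]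
    rw [Finset.sum_sigma']
    symm
    have hnot : ∀ (i : V) (M : Finset (Sym2 V)), M ∈ ecdM G ((W.erase u).erase i) →
        ∀ e ∈ M, u ∉ e ∧ i ∉ e := by
      intro i M hM e he
      have h := ((mem_ecdM.1 hM).1 e he).2
      constructor
      · intro hue
        simpa using h u hue
      · intro hue
        simpa using h i hue
    refine Finset.sum_bij (fun a _ => insert s(u, a.1) a.2) ?_ ?_ ?_ ?_
    · rintro ⟨i, M⟩ ha
      simp only [Finset.mem_sigma, Finset.mem_filter, Finset.mem_erase] at ha
      obtain ⟨⟨⟨hiu, hiW⟩, hadj⟩, hM⟩ := ha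
      have hn := hnot i M hM
      obtain ⟨h1, h2⟩ := mem_ecdM.1 hM
      refine Finset.mem_filter.2 ⟨mem_ecdM.2 ⟨?_, ?_⟩, s(u, i), Finset.mem_insert_self _ _, by simp⟩
      · intro e he
        rcases Finset.mem_insert.1 he with rfl | he
        · refine ⟨hadj, fun v hv => ?_⟩
          rcases Sym2.mem_iff.1 hv with rfl | rfl
          · exact hu
          · exact hiW
        · exact ⟨(h1 e he).1, fun v hv =>
            Finset.mem_of_mem_erase (Finset.mem_of_mem_erase ((h1 e he).2 v hv))⟩
      · intro e he f hf hef v hve hvf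
        rcases Finset.mem_insert.1 he with rfl | he' <;> rcases Finset.mem_insert.1 hf with rfl | hf'
        · exact hef rfl
        · rcases Sym2.mem_iff.1 hve with rfl | rfl
          · exact (hn f hf').1 hvf
          · exact (hn f hf').2 hvf
        · rcases Sym2.mem_iff.1 hvf with rfl | rfl
          · exact (hn e he').1 hve
          · exact (hn e he').2 hve
        · exact h2 e he' f hf' hef v hve hvf
    · rintro ⟨i, M⟩ ha ⟨j, M'⟩ ha' heq
      simp only [Finset.mem_sigma, Finset.mem_filter, Finset.mem_erase] at ha ha' heq
      have hn := hnot i M ha.2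
      have hn' := hnot j M' ha'.2
      have hij : i = j := by
        have : s(u, i) ∈ insert s(u, j) M' := heq ▸ Finset.mem_insert_self _ _
        rcases Finset.mem_insert.1 this with h | h
        · exact Sym2.congr_right.1 h
        · exact absurd (Sym2.mem_mk_left u i) (hn' _ h).1
      subst hij
      have k1 : s(u, i) ∉ M := fun h => (hn _ h).1 (Sym2.mem_mk_left u i)
      have k2 : s(u, i) ∉ M' := fun h => (hn' _ h).1 (Sym2.mem_mk_left u i)
      rw [← Finset.erase_insert k1, heq, Finset.erase_insert k2]
    · intro M hM
      obtain ⟨hM, e, he, hue⟩ := Finset.mem_filter.1 hM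
      obtain ⟨h1, h2⟩ := mem_ecdM.1 hM
      obtain ⟨i, rfl⟩ := Sym2.mem_iff_exists.1 hue
      have hadj : G.Adj u i := (h1 _ he).1
      refine ⟨⟨i, M.erase s(u, i)⟩, ?_, Finset.insert_erase he⟩
      simp only [Finset.mem_sigma, Finset.mem_filter, Finset.mem_erase]
      refine ⟨⟨⟨hadj.ne', (h1 _ he).2 i (Sym2.mem_mk_right u i)⟩, hadj⟩, mem_ecdM.2 ⟨?_, ?_⟩⟩
      · intro f hf
        obtain ⟨hne, hf'⟩ := Finset.mem_erase.1 hf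
        refine ⟨(h1 f hf').1, fun v hv => ?_⟩
        refine Finset.mem_erase.2 ⟨?_, Finset.mem_erase.2 ⟨?_, (h1 f hf').2 v hv⟩⟩
        · rintro rfl
          exact h2 f hf' _ he hne v hv (Sym2.mem_mk_right _ _)
        · rintro rfl
          exact h2 f hf' _ he hne v hv (Sym2.mem_mk_left _ _)
      · intro e he f hf
        exact h2 e (Finset.mem_of_mem_erase he) f (Finset.mem_of_mem_erase hf)
    · rintro ⟨i, M⟩ ha
      simp only [Finset.mem_sigma, Finset.mem_filter] at ha
      have hn := hnot i M ha.2
      have k1 : s(u, i) ∉ M := fun h => (hn _ h).1 (Sym2.mem_mk_left u i)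
      have hc : ((W.erase u).erase i).card + 1 = (W.erase u).card :=
        Finset.card_erase_add_one ha.1.1
      simp only [Finset.card_insert_of_notMem k1]
      rw [show W.card - 2 * (M.card + 1) = ((W.erase u).erase i).card - 2 * M.card by omega,
        pow_succ]
      ring

theorem ecd_link {U V : Type*} [Finite U] [Fintype V] (G : SimpleGraph V) (f : U ↪ V) :
    matchingPolynomial (G.comap f) = ecdQ G ((@Finset.univ U (Fintype.ofFinite U)).map f) := by
  classical
  letI : Fintype U := Fintype.ofFinite U
  rw [matchingPolynomial, ecdQ]
  have hinj : Function.Injective (Sym2.map f) := Sym2.map.injective f.injective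
  refine Finset.sum_bij (fun M _ => M.map ⟨Sym2.map f, hinj⟩) ?_ ?_ ?_ ?_
  · intro M hM
    obtain ⟨h1, h2⟩ := (Finset.mem_filter.1 hM).2
    refine mem_ecdM.2 ⟨?_, ?_⟩
    · intro e he
      obtain ⟨e, he', rfl⟩ := Finset.mem_map.1 he
      have := h1 e he'
      refine ⟨?_, ?_⟩
      · induction e with | _ a b => exact this
      · intro v hv
        obtain ⟨a, _, rfl⟩ := Sym2.mem_map.1 hv
        simp
    · intro e he g hg heg v hv hv'
      obtain ⟨e, he', rfl⟩ := Finset.mem_map.1 he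
      obtain ⟨g, hg', rfl⟩ := Finset.mem_map.1 hg
      obtain ⟨a, ha, rfl⟩ := Sym2.mem_map.1 hv
      obtain ⟨b, hb, hab⟩ := Sym2.mem_map.1 hv'
      have := f.injective hab
      subst this
      exact h2 e he' g hg' (fun h => heg (by rw [h])) b ha hb
  · intro M _ M' _ h
    exact Finset.map_injective _ h
  · intro M hM
    obtain ⟨h1, h2⟩ := mem_ecdM.1 hM
    have hr : ∀ e ∈ M, ∃ e', Sym2.map f e' = e := by
      intro e he
      have := (h1 e he).2
      induction e with | _ a b =>
      obtain ⟨a', _, ha⟩ := Finset.mem_map.1 (this a (by simp))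
      obtain ⟨b', _, hb⟩ := Finset.mem_map.1 (this b (by simp))
      exact ⟨s(a', b'), by simp [ha, hb]⟩
    refine ⟨Finset.univ.filter (fun e => Sym2.map f e ∈ M), ?_, ?_⟩
    · refine Finset.mem_filter.2 ⟨Finset.mem_univ _, ?_, ?_⟩
      · intro e he
        have := (h1 _ (Finset.mem_filter.1 he).2).1
        induction e with | _ a b => exact this
      · intro e he g hg heg v hv hv'
        exact h2 _ (Finset.mem_filter.1 he).2 _ (Finset.mem_filter.1 hg).2
          (fun h => heg (hinj h)) (f v) (Sym2.mem_map.2 ⟨v, hv, rfl⟩) (Sym2.mem_map.2 ⟨v, hv', rfl⟩)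
    · ext e
      simp only [Finset.mem_map, Finset.mem_filter, Finset.mem_univ, true_and,
        Function.Embedding.coeFn_mk]
      constructor
      · rintro ⟨a, ha, rfl⟩; exact ha
      · intro he
        obtain ⟨a, rfl⟩ := hr e he
        exact ⟨a, he, rfl⟩
  · intro M _
    simp

theorem ecd_link' {U V : Type*} [Finite U] [Fintype V] (θ : ℝ) (G : SimpleGraph V) (f : U ↪ V)
    (W : Finset V) (hW : ∀ x, x ∈ W ↔ ∃ y, f y = x) (H : SimpleGraph U) (hH : H = G.comap f) :
    matchMult θ H = (ecdQ G W).rootMultiplicity θ := by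
  letI := Fintype.ofFinite U
  subst hH
  rw [matchMult, ecd_link]
  congr 2
  ext x
  simp [hW]

-- statement 16
theorem essential_component_delete {V : Type*} [Finite V] (θ : ℝ) (G : SimpleGraph V)
    (u v : V) (huv : u ≠ v) (hu : IsEssential θ G u) (hv : IsEssential θ G v)
    (hreach : (G.induce {w | IsEssential θ G w}).Reachable ⟨u, hu⟩ ⟨v, hv⟩) :
    ¬ IsEssential θ (G.induce {w | w ≠ u}) ⟨v, huv.symm⟩ := by
  classical
  have := Fintype.ofFinite V
  have hrec := ecdQ_rec G
  have h0 := ecdQ_empty G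
  have eG : matchMult θ G = (ecdQ G Finset.univ).rootMultiplicity θ :=
    ecd_link' θ G (Function.Embedding.refl V) _ (by simp) G rfl
  have e1 : ∀ a, matchMult θ (G.induce {w | w ≠ a}) =
      (ecdQ G (Finset.univ.erase a)).rootMultiplicity θ := fun a =>
    ecd_link' θ G (Function.Embedding.subtype _) _ (by simp) _ rfl
  have e2 : matchMult θ ((G.induce {w | w ≠ u}).induce {w | w ≠ ⟨v, huv.symm⟩}) =
      (ecdQ G ((Finset.univ.erase u).erase v)).rootMultiplicity θ :=
    ecd_link' θ G ((Function.Embedding.subtype _).trans (Function.Embedding.subtype _)) _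
      (by
        intro x
        simp only [Finset.mem_erase, Finset.mem_univ, and_true]
        constructor
        · rintro ⟨h1, h2⟩
          exact ⟨⟨⟨x, h2⟩, fun h => h1 (congrArg Subtype.val h)⟩, rfl⟩
        · rintro ⟨⟨⟨y, h2⟩, h1⟩, rfl⟩
          exact ⟨fun h => h1 (Subtype.ext h), h2⟩) _ rfl
  have ess : ∀ a, IsEssential θ G a → (ecdQ G (Finset.univ.erase a)).rootMultiplicity θ + 1 =
      (ecdQ G Finset.univ).rootMultiplicity θ := by
    intro a ha
    rw [← e1, ← eG]; exact ha
  have key : ∀ y : {w | IsEssential θ G w},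
      (G.induce {w | IsEssential θ G w}).Reachable ⟨u, hu⟩ y →
      (ecdQ G Finset.univ).rootMultiplicity θ ≤
        (ecdQ G ((Finset.univ.erase u).erase y)).rootMultiplicity θ + 1 := by
    intro y hy
    rw [SimpleGraph.reachable_iff_reflTransGen] at hy
    induction hy with
    | refl =>
      have := ess u hu
      rw [Finset.erase_idem]; omega
    | @tail b c _ hbc ih =>
      exact ecd_trans G _ hrec h0 θ Finset.univ u b c (Finset.mem_univ _) (Finset.mem_univ _)
        (Finset.mem_univ _) (ess u hu) (ess b b.2) (ess c c.2) ih
        (ecd_adj G _ hrec h0 θ Finset.univ b c (Finset.mem_univ _) (Finset.mem_univ _) hbc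
          (ess b b.2) (ess c c.2))
  intro hcon
  rw [IsEssential, e2, e1] at hcon
  have k1 := key ⟨v, hv⟩ hreach
  have k2 := ess u hu
  simp only at k1
  omega
end
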